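/- arXiv:1912.12561 — 5 statements merged into one kernel-verified Lean document; each statement's English description precedes it below -/
import Mathlib

section
/- There exists a universal constant c > 0 such that the following holds. Let f : {-1,1}^n → {0,1} be computed by a decision tree of depth at most d, let p = Pr_{x uniform}[f(x)=1] with p > 0, and let 1 ≤ ℓ ≤ d. Then ∑_{S ⊆ [n], |S|=ℓ} |f̂(S)| ≤ √(c^ℓ · C(d,ℓ)) · p · ∏_{i=0}^{ℓ-1} √(ln(4·n^i/p)), where C(d,ℓ) denotes the binomial coefficient d choose ℓ. -/
open scoped BigOperators

/-- A deterministic decision tree over variables indexed by `α`: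
each internal node queries a variable (the first subtree is followed when the
variable equals `-1`, i.e. `false`, the second when it equals `1`, i.e. `true`),
and each leaf is labeled by `0` or `1` (encoded as a `Bool`). -/
inductive DTree (α : Type) : Type where
  | leaf : Bool → DTree α
  | node : α → DTree α → DTree α → DTree α

namespace DTree

/-- Evaluation of a decision tree on an input in `{-1,1}^α`, encoded as a
function `α → Bool` (`true` stands for `1`, `false` for `-1`); the output
`{0,1}` is given as a real number. -/
def eval {α : Type} : DTree α → (α → Bool) → ℝ
  | leaf b, _ => if b then 1 else 0
  | node i t0 t1, x => if x i then t1.eval x else t0.eval x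

/-- Depth of a decision tree: the maximal number of internal nodes on a
root-to-leaf path. -/
def depth {α : Type} : DTree α → ℕ
  | leaf _ => 0
  | node _ t0 t1 => 1 + max t0.depth t1.depth

end DTree

/-- The Fourier coefficient `f̂(S) = 2^{-n} ∑_{x ∈ {-1,1}^n} f(x) ∏_{i ∈ S} x_i`,
for `f` on `{-1,1}^α` encoded as a function on `α → Bool`. -/
noncomputable def booleanFourierCoeff {α : Type} [Fintype α] [DecidableEq α]
    (f : (α → Bool) → ℝ) (S : Finset α) : ℝ :=
  (∑ x : α → Bool, f x * ∏ i ∈ S, (if x i then (1 : ℝ) else -1)) / 2 ^ Fintype.card α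

/-- The average of `f` over the uniform distribution on `{-1,1}^α`;
for `{0,1}`-valued `f` this is `Pr[f(x) = 1]`. -/
noncomputable def uavg {α : Type} [Fintype α] [DecidableEq α]
    (f : (α → Bool) → ℝ) : ℝ :=
  (∑ x : α → Bool, f x) / 2 ^ Fintype.card α


namespace LevelL

/-- Two-point inequality. -/
lemma two_point_aux (u v : ℝ) (m : ℕ) :
    0 ≤ (2*u*v) * ((u+v)^(2*m) - (u-v)^(2*m)) ∧
    (2*u*v) * ((u+v)^(2*m) - (u-v)^(2*m)) ≤ 4*m*v^2 * ((u+v)^(2*m) + (u-v)^(2*m)) := by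
  induction m with
  | zero => simp
  | succ m ih =>
    obtain ⟨h1, h2⟩ := ih
    have ha : 0 ≤ (u+v)^(2*m) := by rw [pow_mul]; positivity
    have hb : 0 ≤ (u-v)^(2*m) := by rw [pow_mul]; positivity
    have ea : (u+v)^(2*(m+1)) = (u^2+v^2+2*u*v) * (u+v)^(2*m) := by ring
    have eb : (u-v)^(2*(m+1)) = (u^2+v^2-2*u*v) * (u-v)^(2*m) := by ring
    rw [ea, eb]
    set a := (u+v)^(2*m)
    set b := (u-v)^(2*m)
    have hs : 0 ≤ u^2+v^2 := by positivity
    have hm : (0:ℝ) ≤ m := by positivity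
    have e1 : (2*u*v) * ((u^2+v^2+2*u*v) * a - (u^2+v^2-2*u*v) * b)
        = (u^2+v^2) * ((2*u*v)*(a-b)) + (2*u*v)^2*(a+b) := by ring
    have e2 : (u^2+v^2+2*u*v) * a + (u^2+v^2-2*u*v) * b
        = (u^2+v^2)*(a+b) + (2*u*v)*(a-b) := by ring
    rw [e1, e2]
    constructor
    · positivity
    · have h3 := mul_le_mul_of_nonneg_left h2 hs
      have h4 : (2*u*v)^2*(a+b) ≤ 4*v^2*(u^2+v^2)*(a+b) := by
        apply mul_le_mul_of_nonneg_right _ (by positivity)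
        nlinarith [sq_nonneg (v^2)]
      have h5 : 0 ≤ 4*((m:ℝ)+1)*v^2*((2*u*v)*(a-b)) := by positivity
      push_cast
      nlinarith

lemma two_point (u v : ℝ) (m : ℕ) :
    (u+v)^(2*m) + (u-v)^(2*m) ≤ 2 * (u^2 + 4*m*v^2)^m := by
  suffices h : ∀ k : ℕ, k ≤ m → (u+v)^(2*k) + (u-v)^(2*k) ≤ 2 * (u^2 + 4*m*v^2)^k from h m le_rfl
  intro k
  induction k with
  | zero => intro _; norm_num
  | succ k ih =>
    intro hk
    have ih := ih (by omega)
    obtain ⟨h1, h2⟩ := two_point_aux u v k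
    have ha : 0 ≤ (u+v)^(2*k) := by rw [pow_mul]; positivity
    have hb : 0 ≤ (u-v)^(2*k) := by rw [pow_mul]; positivity
    have ea : (u+v)^(2*(k+1)) = (u^2+v^2+2*u*v) * (u+v)^(2*k) := by ring
    have eb : (u-v)^(2*(k+1)) = (u^2+v^2-2*u*v) * (u-v)^(2*k) := by ring
    rw [ea, eb, pow_succ (u^2 + 4*(m:ℝ)*v^2) k]
    set a := (u+v)^(2*k)
    set b := (u-v)^(2*k)
    have hkm : (k:ℝ) + 1 ≤ m := by exact_mod_cast hk
    have h3 : v^2 + 4*k*v^2 ≤ 4*m*v^2 := by nlinarith [sq_nonneg v]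
    have h4 : (u^2+v^2+4*k*v^2)*(a+b) ≤ (u^2+4*m*v^2)*(a+b) :=
      mul_le_mul_of_nonneg_right (by linarith) (by positivity)
    have h5 : (u^2+4*m*v^2)*(a+b) ≤ (u^2+4*m*v^2)*(2 * (u^2 + 4*m*v^2)^k) :=
      mul_le_mul_of_nonneg_left ih (by positivity)
    nlinarith

lemma mink {X : Type*} [Fintype X] (U V : X → ℝ) (hU : ∀ x, 0 ≤ U x) (hV : ∀ x, 0 ≤ V x)
    (A B N : ℝ) (hA : 0 ≤ A) (hB : 0 ≤ B) (m : ℕ) (hm : 1 ≤ m)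
    (h1 : ∑ x, U x ^ m ≤ N * A^m) (h2 : ∑ x, V x ^ m ≤ N * B^m) :
    ∑ x, (U x + V x)^m ≤ N * (A+B)^m := by
  have key : ∀ (W : X → ℝ), (∀ x, 0 ≤ W x) → ∑ x, W x ^ m ≤ N * 0^m → ∀ x, W x = 0 := by
    intro W hW h x
    rw [zero_pow (by omega), mul_zero] at h
    have h0 : ∑ x, W x ^ m = 0 := le_antisymm h (Finset.sum_nonneg fun x _ => pow_nonneg (hW x) m)
    rw [Finset.sum_eq_zero_iff_of_nonneg (fun x _ => pow_nonneg (hW x) m)] at h0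
    exact pow_eq_zero_iff (by omega) |>.1 (h0 x (Finset.mem_univ x))
  rcases hA.eq_or_lt with rfl | hA
  · simpa [key U hU h1] using h2
  rcases hB.eq_or_lt with rfl | hB
  · simpa [key V hV h2] using h1
  have hAB : 0 < A + B := by positivity
  have pt : ∀ x, (U x + V x)^m ≤ (A+B)^m * (A/(A+B) * (U x^m / A^m) + B/(A+B) * (V x^m / B^m)) := by
    intro x
    have hc := (convexOn_pow (𝕜 := ℝ) m).2 (Set.mem_Ici.2 (div_nonneg (hU x) hA.le))
      (Set.mem_Ici.2 (div_nonneg (hV x) hB.le))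
      (show 0 ≤ A/(A+B) by positivity) (show 0 ≤ B/(A+B) by positivity) (by field_simp)
    simp only [smul_eq_mul] at hc
    have e : A/(A+B) * (U x/A) + B/(A+B) * (V x/B) = (U x + V x)/(A+B) := by field_simp
    rw [e, div_pow, div_pow, div_pow, div_le_iff₀ (by positivity)] at hc
    linarith
  calc _ ≤ ∑ x, (A+B)^m * (A/(A+B) * (U x^m / A^m) + B/(A+B) * (V x^m / B^m)) :=
        Finset.sum_le_sum fun x _ => pt x
    _ = (A+B)^m * (A/(A+B) * ((∑ x, U x^m) / A^m) + B/(A+B) * ((∑ x, V x^m) / B^m)) := by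
        rw [← Finset.mul_sum, Finset.sum_add_distrib, ← Finset.mul_sum, ← Finset.mul_sum,
          Finset.sum_div, Finset.sum_div]
    _ ≤ (A+B)^m * (A/(A+B) * N + B/(A+B) * N) := by
        have h1' : (∑ x, U x^m) / A^m ≤ N := by rw [div_le_iff₀ (by positivity)]; exact h1
        have h2' : (∑ x, V x^m) / B^m ≤ N := by rw [div_le_iff₀ (by positivity)]; exact h2
        gcongr
    _ = N * (A+B)^m := by field_simp

lemma highmom {X : Type*} [Fintype X] (y : X → ℝ) (hy : ∀ x, 0 ≤ y x)
    (B : ℝ) (hB : 0 ≤ B) (m L : ℕ) (hm : 1 ≤ m)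
    (h : ∑ x, y x ^ (m+L) ≤ (Fintype.card X : ℝ) * 3^L * B^(m+L)) :
    ∑ x, y x ^ m ≤ (Fintype.card X : ℝ) * (4*B)^m := by
  rcases hB.eq_or_lt with rfl | hB
  · rw [zero_pow (by omega), mul_zero] at h
    have h0 : ∑ x, y x ^ (m+L) = 0 := le_antisymm h (Finset.sum_nonneg fun x _ => pow_nonneg (hy x) _)
    rw [Finset.sum_eq_zero_iff_of_nonneg (fun x _ => pow_nonneg (hy x) _)] at h0
    have h1 : ∀ x, y x = 0 := fun x => pow_eq_zero_iff (by omega) |>.1 (h0 x (Finset.mem_univ x))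
    simp [h1, zero_pow (show m ≠ 0 by omega)]
  have pt : ∀ x, y x ^ m ≤ (3*B)^m + y x^(m+L) / (3*B)^L := by
    intro x
    have hx := hy x
    rcases le_total (y x) (3*B) with h | h
    · have : y x ^ m ≤ (3*B)^m := by gcongr
      have : 0 ≤ y x^(m+L) / (3*B)^L := by positivity
      linarith
    · have h3 : y x^m ≤ y x^(m+L) / (3*B)^L := by
        rw [le_div_iff₀ (by positivity), pow_add]
        gcongr
      have : 0 ≤ (3*B)^m := by positivity
      linarith
  have h4 : (3*B)^m + B^m ≤ (4*B)^m := by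
    obtain ⟨k, rfl⟩ : ∃ k, m = k + 1 := ⟨m - 1, by omega⟩
    have h3 : (3*B)^k ≤ (4*B)^k := by gcongr; norm_num
    have h1 : B^k ≤ (4*B)^k := by gcongr; linarith
    rw [pow_succ, pow_succ, pow_succ]
    nlinarith
  calc _ ≤ ∑ x, ((3*B)^m + y x^(m+L) / (3*B)^L) := Finset.sum_le_sum fun x _ => pt x
    _ = (Fintype.card X : ℝ) * (3*B)^m + (∑ x, y x^(m+L)) / (3*B)^L := by
        rw [Finset.sum_add_distrib, Finset.sum_div]; simp
    _ ≤ (Fintype.card X : ℝ) * (3*B)^m + ((Fintype.card X : ℝ) * 3^L * B^(m+L)) / (3*B)^L := by gcongr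
    _ = (Fintype.card X : ℝ) * ((3*B)^m + B^m) := by
        rw [mul_pow 3 B L, pow_add]; field_simp
    _ ≤ _ := by gcongr

lemma holder {X : Type*} [Fintype X] (f M : X → ℝ) (hf : ∀ x, f x = 0 ∨ f x = 1)
    (B p N : ℝ) (hB : 0 < B) (hp : 0 < p) (hN : 0 < N) (m : ℕ) (h3 : 1 ≤ p * 3^m)
    (hfp : ∑ x, f x = N * p) (hM : ∑ x, M x^(2*m) ≤ N * B^m) (hm : 1 ≤ m) :
    ∑ x, f x * M x ≤ N * (p * Real.sqrt (12 * B)) := by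
  set K := Real.sqrt (3*B) with hK
  have hKpos : 0 < K := Real.sqrt_pos.2 (by positivity)
  have hK2 : K^2 = 3*B := Real.sq_sqrt (by positivity)
  have e12 : Real.sqrt (12*B) = 2*K := by
    rw [show 12*B = 2^2*(3*B) by ring, Real.sqrt_mul (by positivity), Real.sqrt_sq (by norm_num)]
  have hnn : ∀ x, 0 ≤ M x^(2*m) := fun x => by rw [pow_mul]; positivity
  have pt : ∀ x, f x * M x ≤ K * f x + K * (M x^(2*m) / (3*B)^m) := by
    intro x
    have h0 : 0 ≤ K * (M x^(2*m) / (3*B)^m) := mul_nonneg hKpos.le (div_nonneg (hnn x) (by positivity))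
    rcases hf x with h | h
    · rw [h]; simpa using h0
    · rw [h, one_mul, mul_one]
      rcases le_total (M x) K with h' | h'
      · linarith
      · have : M x ≤ K * (M x^(2*m) / (3*B)^m) := by
          rw [← hK2, ← pow_mul, ← div_pow]
          have h1 : 1 ≤ M x / K := by rwa [one_le_div hKpos]
          calc M x = K * (M x / K) := by field_simp
            _ ≤ _ := by
              gcongr
              exact le_self_pow₀ h1 (by omega)
        linarith
  calc _ ≤ ∑ x, (K * f x + K * (M x^(2*m) / (3*B)^m)) := Finset.sum_le_sum fun x _ => pt x
    _ = K * (N*p) + K * ((∑ x, M x^(2*m)) / (3*B)^m) := by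
      rw [Finset.sum_add_distrib, ← Finset.mul_sum, ← Finset.mul_sum, Finset.sum_div, hfp]
    _ ≤ K * (N*p) + K * ((N * B^m) / (3*B)^m) := by gcongr
    _ = K * (N*p) + K * N * (1 / 3^m) := by rw [mul_pow]; field_simp
    _ ≤ K * (N*p) + K * N * p := by
      gcongr
      rw [div_le_iff₀ (by positivity)]; exact h3
    _ = _ := by rw [e12]; ring

/-- The sign of a bit. -/
noncomputable def sg (b : Bool) : ℝ := if b then (1 : ℝ) else -1

/-- The character. -/
noncomputable def chi {n : ℕ} (S : Finset (Fin n)) (x : Fin n → Bool) : ℝ :=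
  ∏ i ∈ S, (if x i then (1 : ℝ) else -1)

/-- flipping a coordinate -/
def flp {n : ℕ} (x : Fin n → Bool) (i : Fin n) : Fin n → Bool := Function.update x i (!x i)

lemma flp_same {n : ℕ} (x : Fin n → Bool) (i : Fin n) : flp x i i = !x i := by simp [flp]
lemma flp_ne {n : ℕ} (x : Fin n → Bool) (i j : Fin n) (h : j ≠ i) : flp x i j = x j := by
  simp [flp, h]
lemma flp_flp {n : ℕ} (x : Fin n → Bool) (i : Fin n) : flp (flp x i) i = x := by
  simp [flp]

lemma chi_congr {n : ℕ} (S : Finset (Fin n)) (x y : Fin n → Bool) (h : ∀ i ∈ S, y i = x i) :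
    chi S y = chi S x := Finset.prod_congr rfl fun i hi => by rw [h i hi]

lemma chi_insert {n : ℕ} (S : Finset (Fin n)) (i : Fin n) (hi : i ∉ S) (x : Fin n → Bool) :
    chi (insert i S) x = sg (x i) * chi S x := by
  simp [chi, Finset.prod_insert hi, sg]

lemma sg_not (b : Bool) : sg (!b) = - sg b := by cases b <;> simp [sg]
lemma sg_sq (b : Bool) : sg b ^ 2 = 1 := by cases b <;> simp [sg]

lemma chi_flp {n : ℕ} (S : Finset (Fin n)) (i : Fin n) (hi : i ∈ S) (x : Fin n → Bool) :
    chi S (flp x i) = - chi S x := by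
  rw [← Finset.insert_erase hi, chi_insert _ _ (by simp), chi_insert _ _ (by simp), flp_same, sg_not,
    chi_congr (S.erase i) x (flp x i)]
  · ring
  · intro j hj; exact flp_ne _ _ _ (Finset.ne_of_mem_erase hj)

/-- An adaptive query process. -/
structure Proc (n : ℕ) where
  Q : ℕ → (Fin n → Bool) → Finset (Fin n)
  q : ℕ → (Fin n → Bool) → Option (Fin n)
  h0 : ∀ x, Q 0 x = ∅
  hnone : ∀ t x, q t x = none → Q (t+1) x = Q t x
  hsome : ∀ t x i, q t x = some i → Q (t+1) x = insert i (Q t x)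
  hnew : ∀ t x i, q t x = some i → i ∉ Q t x
  hadapt : ∀ t x y, (∀ i ∈ Q t x, y i = x i) → Q t y = Q t x ∧ q t y = q t x

/-- The level polynomial restricted to the queried variables. -/
noncomputable def lev {n : ℕ} (P : Proc n) (l : ℕ) (a : Finset (Fin n) → ℝ) (t : ℕ)
    (x : Fin n → Bool) : ℝ :=
  ∑ S ∈ Finset.powersetCard l (P.Q t x), a S * chi S x

/-- flip the queried coordinate -/
def sig {n : ℕ} (P : Proc n) (t : ℕ) (x : Fin n → Bool) : Fin n → Bool :=
  match P.q t x with
  | none => x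
  | some i => flp x i

lemma sig_agree {n : ℕ} (P : Proc n) (t : ℕ) (x : Fin n → Bool) :
    ∀ i ∈ P.Q t x, sig P t x i = x i := by
  intro j hj
  unfold sig
  cases h : P.q t x with
  | none => rfl
  | some i =>
    have := P.hnew t x i h
    exact flp_ne _ _ _ (fun e => this (e ▸ hj))

lemma sig_inv {n : ℕ} (P : Proc n) (t : ℕ) : Function.Involutive (sig P t) := by
  intro x
  have h := (P.hadapt t x _ (sig_agree P t x)).2
  cases hq : P.q t x with
  | none =>
    have e : sig P t x = x := by simp [sig, hq]
    rw [e, e]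
  | some i =>
    have e : sig P t x = flp x i := by simp [sig, hq]
    rw [hq] at h
    have e2 : sig P t (sig P t x) = flp (sig P t x) i := by
      generalize sig P t x = y at h ⊢
      simp [sig, h]
    rw [e2, e, flp_flp]

/-- increment -/
noncomputable def inc {n : ℕ} (P : Proc n) (l : ℕ) (a : Finset (Fin n) → ℝ) (t : ℕ)
    (x : Fin n → Bool) : ℝ :=
  match P.q t x with
  | none => 0
  | some i => sg (x i) * lev P l (fun S => a (insert i S)) t x

lemma lev_congr {n : ℕ} (P : Proc n) (l : ℕ) (a : Finset (Fin n) → ℝ) (t : ℕ)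
    (x y : Fin n → Bool) (h : ∀ i ∈ P.Q t x, y i = x i) : lev P l a t y = lev P l a t x := by
  unfold lev
  rw [(P.hadapt t x y h).1]
  refine Finset.sum_congr rfl fun S hS => ?_
  rw [chi_congr S x y fun i hi => h i ((Finset.mem_powersetCard.1 hS).1 hi)]

lemma lev_succ {n : ℕ} (P : Proc n) (l : ℕ) (a : Finset (Fin n) → ℝ) (t : ℕ)
    (x : Fin n → Bool) : lev P (l+1) a (t+1) x = lev P (l+1) a t x + inc P l a t x := by
  unfold inc
  cases h : P.q t x with
  | none => simp [lev, P.hnone t x h]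
  | some i =>
    have hi := P.hnew t x i h
    have hnot : ∀ S ∈ Finset.powersetCard l (P.Q t x), i ∉ S := fun S hS hiS =>
      hi ((Finset.mem_powersetCard.1 hS).1 hiS)
    simp only [lev, P.hsome t x i h]
    rw [Finset.powersetCard_succ_insert hi, Finset.sum_union, Finset.sum_image, Finset.mul_sum]
    · congr 1
      refine Finset.sum_congr rfl fun S hS => ?_
      rw [chi_insert _ _ (hnot S hS)]; ring
    · intro S hS T hT e
      rw [← Finset.erase_insert (hnot S hS), e, Finset.erase_insert (hnot T hT)]
    · rw [Finset.disjoint_left]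
      intro S hS hS'
      obtain ⟨T, hT, rfl⟩ := Finset.mem_image.1 hS'
      exact hi ((Finset.mem_powersetCard.1 hS).1 (Finset.mem_insert_self i T))

lemma inc_sig {n : ℕ} (P : Proc n) (l : ℕ) (a : Finset (Fin n) → ℝ) (t : ℕ)
    (x : Fin n → Bool) : inc P l a t (sig P t x) = - inc P l a t x := by
  have h := (P.hadapt t x _ (sig_agree P t x)).2
  unfold inc
  rw [h]
  cases hq : P.q t x with
  | none => simp
  | some i =>
    have e : sig P t x i = !x i := by simp [sig, hq, flp_same]
    simp only
    rw [e, sg_not, lev_congr P l _ t x _ (sig_agree P t x)]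
    ring

lemma inc_pow {n : ℕ} (P : Proc n) (l : ℕ) (a : Finset (Fin n) → ℝ) (t k : ℕ) (hk : 1 ≤ k)
    (x : Fin n → Bool) :
    (inc P l a t x ^ 2) ^ k ≤ ∑ i, lev P l (fun S => a (insert i S)) t x ^ (2*k) := by
  have hnn : ∀ i, 0 ≤ lev P l (fun S => a (insert i S)) t x ^ (2*k) := fun i => by
    rw [pow_mul]; positivity
  unfold inc
  cases hq : P.q t x with
  | none =>
    simp only
    rw [zero_pow (by norm_num), zero_pow (by omega)]
    exact Finset.sum_nonneg fun i _ => hnn i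
  | some i =>
    simp only
    rw [mul_pow, sg_sq, one_mul, ← pow_mul]
    exact Finset.single_le_sum (f := fun i => lev P l (fun S => a (insert i S)) t x ^ (2*k))
      (fun i _ => hnn i) (Finset.mem_univ i)

/-- The bound. -/
noncomputable def bd (L l t m : ℕ) : ℝ :=
  16^l * (t.choose l) * ∏ i ∈ Finset.range l, ((m:ℝ) + i * L)

lemma bd_nonneg (L l t m : ℕ) : 0 ≤ bd L l t m := by unfold bd; positivity

lemma bd_succ (L l t m : ℕ) :
    bd L (l+1) t m + 4 * m * (4 * bd L l t (m+L)) = bd L (l+1) (t+1) m := by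
  unfold bd
  rw [Finset.prod_range_succ', Nat.choose_succ_succ']
  have : ∏ i ∈ Finset.range l, (((m+L : ℕ):ℝ) + i * L)
      = ∏ i ∈ Finset.range l, ((m:ℝ) + ((i+1 : ℕ):ℝ) * L) :=
    Finset.prod_congr rfl fun i _ => by push_cast; ring
  rw [this]
  push_cast
  ring

lemma moment {n : ℕ} (P : Proc n) (L : ℕ) (hL : (n:ℝ) ≤ 3^L) (l : ℕ) :
    ∀ (t m : ℕ) (a : Finset (Fin n) → ℝ), 1 ≤ m → (∀ S, |a S| ≤ 1) →
      ∑ x, lev P l a t x ^ (2*m) ≤ (Fintype.card (Fin n → Bool) : ℝ) * bd L l t m ^ m := by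
  induction l with
  | zero =>
    intro t m a hm ha
    have : ∀ x, lev P 0 a t x = a ∅ := fun x => by simp [lev, chi]
    simp only [this, bd]
    have h1 : a ∅ ^ (2*m) ≤ 1 := by
      rw [pow_mul, ← sq_abs]
      exact pow_le_one₀ (by positivity) (pow_le_one₀ (abs_nonneg _) (ha ∅))
    rw [Finset.sum_const, Finset.card_univ, nsmul_eq_mul]
    simp only [pow_zero, Nat.choose_zero_right, Nat.cast_one, Finset.range_zero, Finset.prod_empty,
      one_pow, mul_one]
    exact mul_le_of_le_one_right (by positivity) h1
  | succ l ihl =>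
    intro t m a hm ha
    induction t with
    | zero =>
      have : ∀ x, lev P (l+1) a 0 x = 0 := fun x => by
        simp only [lev, P.h0]
        rw [Finset.powersetCard_eq_empty.2 (by simp), Finset.sum_empty]
      simp only [this]
      rw [zero_pow (by omega)]
      simp only [Finset.sum_const_zero]
      have := bd_nonneg L (l+1) 0 m
      positivity
    | succ t iht =>
      have sym : ∑ x, lev P (l+1) a (t+1) x ^ (2*m)
          = ∑ x, (lev P (l+1) a t x - inc P l a t x)^(2*m) := by
        rw [← Equiv.sum_comp (sig_inv P t).toPerm]
        refine Finset.sum_congr rfl fun x _ => ?_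
        simp only [Function.Involutive.coe_toPerm]
        rw [lev_succ, inc_sig, lev_congr P _ _ t x _ (sig_agree P t x)]
        ring
      have sym2 : 2 * ∑ x, lev P (l+1) a (t+1) x ^ (2*m)
          ≤ 2 * ∑ x, (lev P (l+1) a t x ^ 2 + 4 * m * inc P l a t x ^2)^m := by
        rw [two_mul]
        nth_rw 2 [sym]
        rw [← Finset.sum_add_distrib, Finset.mul_sum]
        refine Finset.sum_le_sum fun x _ => ?_
        rw [lev_succ]
        exact two_point _ _ _
      have hi : ∑ x, (inc P l a t x ^ 2)^m
          ≤ (Fintype.card (Fin n → Bool) : ℝ) * (4 * bd L l t (m+L))^m := by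
        apply highmom _ (fun x => sq_nonneg _) _ (bd_nonneg _ _ _ _) m L hm
        calc _ ≤ ∑ x, ∑ i, lev P l (fun S => a (insert i S)) t x ^ (2*(m+L)) :=
              Finset.sum_le_sum fun x _ => inc_pow P l a t (m+L) (by omega) x
          _ = ∑ i, ∑ x, lev P l (fun S => a (insert i S)) t x ^ (2*(m+L)) := Finset.sum_comm
          _ ≤ ∑ i : Fin n, (Fintype.card (Fin n → Bool) : ℝ) * bd L l t (m+L) ^ (m+L) :=
              Finset.sum_le_sum fun i _ => ihl t (m+L) _ (by omega) (fun S => ha _)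
          _ = n * ((Fintype.card (Fin n → Bool) : ℝ) * bd L l t (m+L) ^ (m+L)) := by simp
          _ ≤ 3^L * ((Fintype.card (Fin n → Bool) : ℝ) * bd L l t (m+L) ^ (m+L)) := by
              have := bd_nonneg L l t (m+L)
              gcongr
          _ = _ := by ring
      have := mink (fun x => lev P (l+1) a t x ^ 2) (fun x => 4 * m * inc P l a t x ^2)
        (fun x => sq_nonneg _) (fun x => by positivity) (bd L (l+1) t m)
        (4 * m * (4 * bd L l t (m+L))) (Fintype.card (Fin n → Bool) : ℝ) (bd_nonneg _ _ _ _)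
        (by have := bd_nonneg L l t (m+L); positivity) m hm
        (by simpa [← pow_mul] using iht)
        (by
          simp only [mul_pow (4 * (m:ℝ))]
          rw [← Finset.mul_sum]
          calc _ ≤ (4*(m:ℝ))^m * ((Fintype.card (Fin n → Bool) : ℝ) * (4 * bd L l t (m+L))^m) := by
                gcongr
            _ = _ := by ring)
      rw [bd_succ] at this
      linarith

/-- states of a tree -/
def st {n : ℕ} (T : DTree (Fin n)) (x : Fin n → Bool) : ℕ → DTree (Fin n)
  | 0 => T
  | t+1 => match st T x t with
    | .leaf b => .leaf b
    | .node i t0 t1 => if x i then t1 else t0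

/-- current query -/
def qr {n : ℕ} : DTree (Fin n) → Option (Fin n)
  | .leaf _ => none
  | .node i _ _ => some i

/-- queried set -/
def QQ {n : ℕ} (T : DTree (Fin n)) (x : Fin n → Bool) : ℕ → Finset (Fin n)
  | 0 => ∅
  | t+1 => match qr (st T x t) with
    | none => QQ T x t
    | some i => insert i (QQ T x t)

/-- new query -/
def qq {n : ℕ} (T : DTree (Fin n)) (x : Fin n → Bool) (t : ℕ) : Option (Fin n) :=
  match qr (st T x t) with
  | none => none
  | some i => if i ∈ QQ T x t then none else some i

lemma adapt {n : ℕ} (T : DTree (Fin n)) (t : ℕ) (x y : Fin n → Bool) :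
    (∀ i ∈ QQ T x t, y i = x i) → QQ T y t = QQ T x t ∧ st T y t = st T x t := by
  induction t with
  | zero => intro _; exact ⟨rfl, rfl⟩
  | succ t ih =>
    intro h
    cases hs : st T x t with
    | leaf b =>
      have e : QQ T x (t+1) = QQ T x t := by simp [QQ, hs, qr]
      rw [e] at h ⊢
      obtain ⟨h1, h2⟩ := ih h
      rw [hs] at h2
      simp [QQ, st, hs, h2, qr, h1]
    | node i t0 t1 =>
      have e : QQ T x (t+1) = insert i (QQ T x t) := by simp [QQ, hs, qr]
      rw [e] at h
      obtain ⟨h1, h2⟩ := ih (fun j hj => h j (Finset.mem_insert_of_mem hj))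
      rw [hs] at h2
      have hi := h i (Finset.mem_insert_self _ _)
      simp [QQ, st, hs, h2, qr, h1, hi]

/-- the process of a tree -/
def procOf {n : ℕ} (T : DTree (Fin n)) : Proc n where
  Q t x := QQ T x t
  q t x := qq T x t
  h0 _ := rfl
  hnone t x h := by
    unfold qq at h
    cases hq : qr (st T x t) with
    | none => simp [QQ, hq]
    | some i =>
      simp only [hq] at h
      have : i ∈ QQ T x t := by by_contra hc; simp [hc] at h
      simp [QQ, hq, this]
  hsome t x i h := by
    unfold qq at h
    cases hq : qr (st T x t) with
    | none => simp [hq] at h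
    | some j =>
      simp only [hq] at h
      split_ifs at h
      simp only [Option.some.injEq] at h
      subst h
      simp [QQ, hq]
  hnew t x i h := by
    unfold qq at h
    cases hq : qr (st T x t) with
    | none => simp [hq] at h
    | some j =>
      simp only [hq] at h
      split_ifs at h with h'
      simp only [Option.some.injEq] at h
      subst h
      exact h'
  hadapt t x y h := by
    obtain ⟨h1, h2⟩ := adapt T t x y h
    exact ⟨h1, by simp only [qq, h1, h2]⟩

lemma eval_st {n : ℕ} (T : DTree (Fin n)) (x : Fin n → Bool) (t : ℕ) :
    (st T x t).eval x = T.eval x := by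
  induction t with
  | zero => rfl
  | succ t ih =>
    rw [← ih]
    cases hs : st T x t with
    | leaf b => simp [st, hs]
    | node i t0 t1 => by_cases hx : x i <;> simp [st, hs, DTree.eval, hx]

lemma depth_st {n : ℕ} (T : DTree (Fin n)) (x : Fin n → Bool) (t : ℕ) :
    (st T x t).depth ≤ T.depth - t := by
  induction t with
  | zero => exact le_rfl
  | succ t ih =>
    cases hs : st T x t with
    | leaf b => simp [st, hs, DTree.depth]
    | node i t0 t1 =>
      rw [hs] at ih
      simp only [DTree.depth] at ih
      by_cases hx : x i <;> simp [st, hs, hx] <;> omega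

lemma eval_adapt {n : ℕ} (T : DTree (Fin n)) (d : ℕ) (hd : T.depth ≤ d) (x y : Fin n → Bool)
    (h : ∀ i ∈ QQ T x d, y i = x i) : T.eval y = T.eval x := by
  have h2 := (adapt T d x y h).2
  rw [← eval_st T x d, ← eval_st T y d, h2]
  have := depth_st T x d
  cases hs : st T x d with
  | leaf b => rfl
  | node i t0 t1 => rw [hs] at this; simp only [DTree.depth] at this; omega

lemma eval_01 {n : ℕ} (T : DTree (Fin n)) (x : Fin n → Bool) : T.eval x = 0 ∨ T.eval x = 1 := by
  induction T with
  | leaf b => cases b <;> simp [DTree.eval]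
  | node i t0 t1 h0 h1 => by_cases hx : x i <;> simp [DTree.eval, hx, h0, h1]

/-- first unqueried element of S -/
noncomputable def tau {n : ℕ} (T : DTree (Fin n)) (d : ℕ) (S : Finset (Fin n)) (x : Fin n → Bool) :
    Fin n → Bool :=
  if h : (S \ QQ T x d).Nonempty then flp x ((S \ QQ T x d).min' h) else x

lemma tau_agree {n : ℕ} (T : DTree (Fin n)) (d : ℕ) (S : Finset (Fin n)) (x : Fin n → Bool) :
    ∀ i ∈ QQ T x d, tau T d S x i = x i := by
  intro i hi
  unfold tau
  split_ifs with h
  · apply flp_ne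
    rintro rfl
    exact (Finset.mem_sdiff.1 ((S \ QQ T x d).min'_mem h)).2 hi
  · rfl

lemma tau_inv {n : ℕ} (T : DTree (Fin n)) (d : ℕ) (S : Finset (Fin n)) :
    Function.Involutive (tau T d S) := by
  intro x
  have hQ := (adapt T d x _ (tau_agree T d S x)).1
  by_cases h : (S \ QQ T x d).Nonempty
  · have e2 : tau T d S (tau T d S x) = flp (tau T d S x) ((S \ QQ T x d).min' h) := by
      generalize tau T d S x = y at hQ ⊢
      simp [tau, hQ, h]
    rw [e2]
    have e1 : tau T d S x = flp x ((S \ QQ T x d).min' h) := by simp [tau, h]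
    rw [e1, flp_flp]
  · have e1 : tau T d S x = x := by simp only [tau, h, dif_neg, not_false_eq_true]
    rw [e1, e1]

lemma sum_unq {n : ℕ} (T : DTree (Fin n)) (d : ℕ) (hd : T.depth ≤ d) (S : Finset (Fin n)) :
    ∑ x, T.eval x * chi S x = ∑ x, if S ⊆ QQ T x d then T.eval x * chi S x else 0 := by
  have key : ∑ x, (if S ⊆ QQ T x d then 0 else T.eval x * chi S x) = 0 := by
    have : ∑ x, (if S ⊆ QQ T x d then 0 else T.eval x * chi S x)
        = - ∑ x, (if S ⊆ QQ T x d then 0 else T.eval x * chi S x) := by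
      conv_lhs => rw [← Equiv.sum_comp (tau_inv T d S).toPerm]
      rw [← Finset.sum_neg_distrib]
      refine Finset.sum_congr rfl fun x _ => ?_
      change (if S ⊆ QQ T (tau T d S x) d then 0 else T.eval (tau T d S x) * chi S (tau T d S x)) = _
      rw [(adapt T d x _ (tau_agree T d S x)).1, eval_adapt T d hd x _ (tau_agree T d S x)]
      split_ifs with h
      · simp
      · have h' : (S \ QQ T x d).Nonempty := Finset.sdiff_nonempty.2 h
        have e1 : tau T d S x = flp x ((S \ QQ T x d).min' h') := by simp [tau, h']
        rw [e1, chi_flp _ _ (Finset.mem_sdiff.1 ((S \ QQ T x d).min'_mem h')).1]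
        ring
    linarith
  refine Eq.trans ?_ (add_zero _)
  refine Eq.trans ?_ (congrArg _ key)
  rw [← Finset.sum_add_distrib]
  refine Finset.sum_congr rfl fun x _ => ?_
  split_ifs <;> simp

lemma sum_lev {n : ℕ} (T : DTree (Fin n)) (d : ℕ) (hd : T.depth ≤ d) (l : ℕ)
    (a : Finset (Fin n) → ℝ) :
    ∑ S ∈ Finset.univ.filter (fun S : Finset (Fin n) => S.card = l),
      a S * ∑ x, T.eval x * chi S x = ∑ x, T.eval x * lev (procOf T) l a d x := by
  simp_rw [sum_unq T d hd, Finset.mul_sum]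
  rw [Finset.sum_comm]
  refine Finset.sum_congr rfl fun x _ => ?_
  have : Finset.powersetCard l ((procOf T).Q d x)
      = (Finset.univ.filter (fun S : Finset (Fin n) => S.card = l)).filter (fun S => S ⊆ QQ T x d) := by
    ext S; simp [Finset.mem_powersetCard, procOf, and_comm]
  rw [lev, this, Finset.mul_sum, Finset.sum_filter (p := fun S => S ⊆ QQ T x d)]
  refine Finset.sum_congr rfl fun S _ => ?_
  split_ifs
  · ring
  · simp

end LevelL

open LevelL
/-- Level-`ℓ` inequality for decision trees:
there is a universal constant `c > 0` such that for every Boolean function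
`f : {-1,1}^n → {0,1}` computed by a decision tree of depth at most `d`, with
`p = Pr[f(x)=1] > 0` and `1 ≤ ℓ ≤ d`, we have
`∑_{|S|=ℓ} |f̂(S)| ≤ √(c^ℓ·C(d,ℓ))·p·∏_{i=0}^{ℓ-1} √(ln(4·n^i/p))`. -/
theorem level_l_inequality_decision_trees :
    ∃ c : ℝ, 0 < c ∧
      ∀ (n d ℓ : ℕ) (f : (Fin n → Bool) → ℝ) (T : DTree (Fin n)),
        T.depth ≤ d → (∀ x, f x = T.eval x) →
        0 < uavg f → 1 ≤ ℓ → ℓ ≤ d →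
        ∑ S ∈ Finset.univ.filter (fun S : Finset (Fin n) => S.card = ℓ),
            |booleanFourierCoeff f S| ≤
          Real.sqrt (c ^ ℓ * (d.choose ℓ)) * uavg f *
            ∏ i ∈ Finset.range ℓ, Real.sqrt (Real.log (4 * (n : ℝ) ^ i / uavg f)) := by
  refine ⟨384, by norm_num, ?_⟩
  intro n d ℓ f T hT hf hp hl hld
  obtain rfl : f = T.eval := funext hf
  rcases Nat.eq_zero_or_pos n with rfl | hn
  · rw [Finset.sum_eq_zero]
    · positivity
    · intro S hS
      have h1 := (Finset.mem_filter.1 hS).2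
      have h2 := Finset.card_le_univ S
      simp at h2
      simp [h2] at h1
      omega
  set p := uavg T.eval with hpdef
  have hN : (0:ℝ) < 2 ^ Fintype.card (Fin n) := by positivity
  have hcard : (Fintype.card (Fin n → Bool) : ℝ) = 2 ^ Fintype.card (Fin n) := by simp
  have hfp : ∑ x, T.eval x = 2 ^ Fintype.card (Fin n) * p := by
    rw [hpdef, uavg]; field_simp
  have hp1 : p ≤ 1 := by
    have h : ∑ x, T.eval x ≤ ∑ x : Fin n → Bool, (1:ℝ) := Finset.sum_le_sum fun x _ => by
      rcases eval_01 T x with h | h <;> rw [h] <;> norm_num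
    rw [hfp, Finset.sum_const, Finset.card_univ, nsmul_eq_mul, hcard] at h
    exact le_of_mul_le_mul_left h hN
  have hlp : 0 ≤ Real.log (1/p) := Real.log_nonneg (by rw [le_div_iff₀ hp]; linarith)
  have hn1 : (1:ℝ) ≤ n := by exact_mod_cast hn
  have hln : 0 ≤ Real.log n := Real.log_nonneg hn1
  have exp3 : Real.exp 1 ≤ 3 := by linarith [Real.exp_one_lt_d9]
  have pow3 : ∀ (k : ℕ) (y : ℝ), 0 < y → Real.log y ≤ k → y ≤ 3^k := by
    intro k y hy h
    calc y = Real.exp (Real.log y) := (Real.exp_log hy).symm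
      _ ≤ Real.exp k := Real.exp_le_exp.2 h
      _ = Real.exp 1 ^ k := by rw [← Real.exp_nat_mul, mul_one]
      _ ≤ 3^k := by gcongr
  set L := ⌈Real.log n⌉₊ with hLdef
  set m := ⌈Real.log (1/p)⌉₊ + 1 with hmdef
  have hL3 : (n:ℝ) ≤ 3^L := pow3 L n (by linarith) (Nat.le_ceil _)
  have hm3 : 1 ≤ p * 3^m := by
    have := pow3 m (1/p) (by positivity) (by
      have := Nat.le_ceil (Real.log (1/p)); rw [hmdef]; push_cast; linarith)
    rw [div_le_iff₀ hp] at this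
    linarith
  have hm2 : (m:ℝ) ≤ Real.log (1/p) + 2 := by
    have := Nat.ceil_lt_add_one hlp
    rw [hmdef]; push_cast; linarith
  have hl2 : (0.6931471803:ℝ) < Real.log 2 := Real.log_two_gt_d9
  have hL2 : (L:ℝ) ≤ 2 * Real.log n := by
    rcases Nat.lt_or_ge 1 n with h2 | h2
    · have hlog : Real.log 2 ≤ Real.log n := Real.log_le_log (by norm_num) (by exact_mod_cast h2)
      rcases le_total (Real.log n) 1 with h3 | h3
      · have : L ≤ 1 := Nat.ceil_le.2 (by simpa using h3)
        have : (L:ℝ) ≤ 1 := by exact_mod_cast this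
        linarith
      · have := Nat.ceil_lt_add_one hln
        linarith
    · have : n = 1 := by omega
      have : L = 0 := by rw [hLdef, this]; simp
      rw [this]; simp; linarith
  set a : Finset (Fin n) → ℝ := fun S => SignType.sign (booleanFourierCoeff T.eval S) with ha
  have ha1 : ∀ S, |a S| ≤ 1 := by
    intro S
    simp only [ha]
    rcases SignType.trichotomy (SignType.sign (booleanFourierCoeff T.eval S)) with h | h | h <;>
      simp [h]
  have hlhs : ∑ S ∈ Finset.univ.filter (fun S : Finset (Fin n) => S.card = ℓ),
      |booleanFourierCoeff T.eval S| = (∑ x, T.eval x * lev (procOf T) ℓ a d x) / 2 ^ Fintype.card (Fin n) := by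
    rw [← sum_lev T d hT, Finset.sum_div]
    refine Finset.sum_congr rfl fun S _ => ?_
    rw [mul_div_assoc]
    exact (sign_mul_self _).symm
  have hm1 : 1 ≤ m := by omega
  have hmom := moment (procOf T) L hL3 ℓ d m a hm1 ha1
  rw [hcard] at hmom
  have hmpos : (0:ℝ) < m := by exact_mod_cast hm1
  have hBpos : 0 < bd L ℓ d m := by
    unfold bd
    have : 0 < d.choose ℓ := Nat.choose_pos hld
    have : 0 < ∏ i ∈ Finset.range ℓ, ((m:ℝ) + i * L) := Finset.prod_pos fun i _ => by positivity
    positivity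
  have hh := holder T.eval (lev (procOf T) ℓ a d) (eval_01 T) (bd L ℓ d m) p _ hBpos hp hN m hm3
    hfp hmom hm1
  rw [hlhs, div_le_iff₀ hN]
  refine hh.trans ?_
  rw [mul_comm]
  refine mul_le_mul_of_nonneg_right ?_ hN.le
  have hlogi : ∀ i : ℕ, (m:ℝ) + i * L ≤ 2 * Real.log (4 * (n:ℝ)^i / p) := by
    intro i
    have e : Real.log (4 * (n:ℝ)^i / p) = 2 * Real.log 2 + i * Real.log n + Real.log (1/p) := by
      rw [mul_div_assoc, Real.log_mul (by norm_num) (by positivity), div_eq_mul_one_div,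
        Real.log_mul (by positivity) (by positivity), Real.log_pow,
        show (4:ℝ) = 2^2 by norm_num, Real.log_pow]
      push_cast; ring
    rw [e]
    have : (i:ℝ) * L ≤ i * (2 * Real.log n) := by gcongr
    linarith
  have hlog0 : ∀ i : ℕ, 0 ≤ Real.log (4 * (n:ℝ)^i / p) := fun i => by
    have := hlogi i
    have : 0 ≤ (m:ℝ) + i * L := by positivity
    linarith
  rw [← Real.sqrt_prod _ (fun i _ => hlog0 i), mul_comm (Real.sqrt _) p, mul_assoc,
    ← Real.sqrt_mul (by positivity)]
  refine mul_le_mul_of_nonneg_left (Real.sqrt_le_sqrt ?_) hp.le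
  have hprod : ∏ i ∈ Finset.range ℓ, ((m:ℝ) + i * L)
      ≤ 2^ℓ * ∏ i ∈ Finset.range ℓ, Real.log (4 * (n:ℝ)^i / p) := by
    calc _ ≤ ∏ i ∈ Finset.range ℓ, (2 * Real.log (4 * (n:ℝ)^i / p)) :=
          Finset.prod_le_prod (fun i _ => by positivity) (fun i _ => hlogi i)
      _ = _ := by rw [Finset.prod_mul_distrib]; simp
  have hprod0 : 0 ≤ ∏ i ∈ Finset.range ℓ, Real.log (4 * (n:ℝ)^i / p) :=
    Finset.prod_nonneg fun i _ => hlog0 i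
  unfold bd
  calc 12 * (16^ℓ * (d.choose ℓ : ℝ) * ∏ i ∈ Finset.range ℓ, ((m:ℝ) + i * L))
      ≤ 12 * (16^ℓ * (d.choose ℓ : ℝ) * (2^ℓ * ∏ i ∈ Finset.range ℓ, Real.log (4 * (n:ℝ)^i / p))) := by
        gcongr
    _ = 12 * (32^ℓ * ((d.choose ℓ : ℝ) * ∏ i ∈ Finset.range ℓ, Real.log (4 * (n:ℝ)^i / p))) := by
        rw [show (32:ℝ) = 16*2 by norm_num, mul_pow]; ring
    _ ≤ 12^ℓ * (32^ℓ * ((d.choose ℓ : ℝ) * ∏ i ∈ Finset.range ℓ, Real.log (4 * (n:ℝ)^i / p))) := by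
        gcongr
        exact le_self_pow₀ (by norm_num) (by omega)
    _ = _ := by
        rw [show (384:ℝ) = 12*32 by norm_num, mul_pow]; ring
end

section
/- There exists a universal constant C > 0 such that the following holds. Let n ≥ 2, let f : {-1,1}^n → {0,1} be computed by a decision tree of depth at most d, and let 1 ≤ ℓ ≤ d. Then ∑_{S ⊆ [n], |S|=ℓ} |f̂(S)| ≤ √(d^ℓ · (C · ln n)^{ℓ-1}). -/
open scoped BigOperators

namespace LevelIneq

open Finset

/-- The character. -/
noncomputable def chi {n : ℕ} (S : Finset (Fin n)) (x : Fin n → Bool) : ℝ :=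
  ∏ i ∈ S, (if x i then (1 : ℝ) else -1)

/-- Flip one coordinate. -/
def flip {n : ℕ} (i : Fin n) (x : Fin n → Bool) : Fin n → Bool :=
  Function.update x i (!x i)

lemma flip_flip {n : ℕ} (i : Fin n) (x : Fin n → Bool) : flip i (flip i x) = x := by
  funext k
  by_cases h : k = i
  · subst h; simp [flip]
  · simp [flip, h]

lemma flip_of_ne {n : ℕ} {i k : Fin n} (x : Fin n → Bool) (h : k ≠ i) : flip i x k = x k := by
  simp [flip, h]

lemma chi_flip_of_not_mem {n : ℕ} {i : Fin n} {S : Finset (Fin n)} (x : Fin n → Bool)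
    (h : i ∉ S) : chi S (flip i x) = chi S x := by
  unfold chi
  refine Finset.prod_congr rfl fun k hk => ?_
  have hki : k ≠ i := by rintro rfl; exact h hk
  rw [flip_of_ne x hki]

lemma chi_insert {n : ℕ} {i : Fin n} {S : Finset (Fin n)} (x : Fin n → Bool)
    (h : i ∉ S) : chi (insert i S) x = (if x i then (1 : ℝ) else -1) * chi S x := by
  unfold chi
  rw [Finset.prod_insert h]

lemma sgn_flip {n : ℕ} (i : Fin n) (x : Fin n → Bool) :
    (if flip i x i then (1 : ℝ) else -1) = - (if x i then (1 : ℝ) else -1) := by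
  cases h : x i <;> simp [flip, h]

lemma chi_flip_of_mem {n : ℕ} {i : Fin n} {S : Finset (Fin n)} (x : Fin n → Bool)
    (h : i ∈ S) : chi S (flip i x) = - chi S x := by
  rw [← Finset.insert_erase h, chi_insert _ (Finset.notMem_erase i S),
    chi_insert _ (Finset.notMem_erase i S), chi_flip_of_not_mem _ (Finset.notMem_erase i S),
    sgn_flip]
  ring

/-- Binomial comparison used in the two-point inequality. -/
lemma choose_cmp (q i : ℕ) (hq : 1 ≤ q) :
    (2 * q).choose (2 * i) ≤ q.choose i * (2 * q - 1) ^ i := by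
  induction i with
  | zero => simp
  | succ i ih =>
    rcases Nat.lt_or_ge i q with h | h
    · obtain ⟨r, rfl⟩ : ∃ r, q = i + r + 1 := ⟨q - i - 1, by omega⟩
      have h1 := Nat.choose_succ_right_eq (2 * (i + r + 1)) (2 * i)
      have h2 := Nat.choose_succ_right_eq (2 * (i + r + 1)) (2 * i + 1)
      have h3 := Nat.choose_succ_right_eq (i + r + 1) i
      have e1 : 2 * (i + r + 1) - 2 * i = 2 * r + 2 := by omega
      have e2 : 2 * (i + r + 1) - (2 * i + 1) = 2 * r + 1 := by omega
      have e3 : i + r + 1 - i = r + 1 := by omega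
      have e4 : 2 * (i + r + 1) - 1 = 2 * i + 2 * r + 1 := by omega
      rw [e1] at h1
      rw [e2] at h2
      rw [e3] at h3
      rw [e4] at ih ⊢
      rw [show 2 * (i + 1) = 2 * i + 1 + 1 by ring]
      generalize (2 * (i + r + 1)).choose (2 * i + 1 + 1) = A at *
      generalize (2 * (i + r + 1)).choose (2 * i + 1) = B at *
      generalize (2 * (i + r + 1)).choose (2 * i) = D at *
      generalize (i + r + 1).choose (i + 1) = E at *
      generalize (i + r + 1).choose i = F at *
      rw [pow_succ]
      generalize (2 * i + 2 * r + 1) ^ i = G at *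
      have key : A * ((2 * i + 2) * (2 * i + 1)) ≤
          E * (G * (2 * i + 2 * r + 1)) * ((2 * i + 2) * (2 * i + 1)) := by
        calc A * ((2 * i + 2) * (2 * i + 1)) = (A * (2 * i + 1 + 1)) * (2 * i + 1) := by ring
          _ = (B * (2 * i + 1)) * (2 * r + 1) := by rw [h2]; ring
          _ = D * ((2 * r + 2) * (2 * r + 1)) := by rw [h1]; ring
          _ ≤ (F * G) * ((2 * r + 2) * (2 * r + 1)) := Nat.mul_le_mul_right _ ih
          _ = (F * (r + 1)) * (2 * G * (2 * r + 1)) := by ring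
          _ = (E * (i + 1)) * (2 * G * (2 * r + 1)) := by rw [h3]
          _ = (E * G * (2 * i + 2)) * (2 * r + 1) := by ring
          _ ≤ (E * G * (2 * i + 2)) * ((2 * i + 2 * r + 1) * (2 * i + 1)) := by
              apply Nat.mul_le_mul_left
              nlinarith [Nat.zero_le (i * (2 * i + 2 * r + 1))]
          _ = _ := by ring
      exact Nat.le_of_mul_le_mul_right key (by positivity)
    · rw [Nat.choose_eq_zero_of_lt (by omega)]
      exact Nat.zero_le _

lemma add_pow_add_sub_pow (q : ℕ) (a b : ℝ) :
    (a + b) ^ (2 * q) + (a - b) ^ (2 * q) =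
      2 * ∑ i ∈ range (q + 1), ((2 * q).choose (2 * i) : ℝ) * (b ^ 2) ^ i * (a ^ 2) ^ (q - i) := by
  have hsplit : ∀ (g : ℕ → ℝ) (m : ℕ), ∑ k ∈ range (2 * m + 1), g k =
      ∑ i ∈ range (m + 1), g (2 * i) + ∑ i ∈ range m, g (2 * i + 1) := by
    intro g m
    induction m with
    | zero => simp
    | succ m ih =>
      rw [show 2 * (m + 1) + 1 = (2 * m + 1) + 1 + 1 by ring, Finset.sum_range_succ,
        Finset.sum_range_succ, ih, Finset.sum_range_succ (fun i => g (2 * i)) (m + 1),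
        Finset.sum_range_succ (fun i => g (2 * i + 1)) m]
      rw [show 2 * (m + 1) = 2 * m + 1 + 1 by ring]
      ring
  rw [sub_eq_add_neg, add_comm a b, add_comm a (-b), add_pow, add_pow, ← Finset.sum_add_distrib,
    hsplit, Finset.mul_sum]
  have hodd : ∑ i ∈ range q, (b ^ (2 * i + 1) * a ^ (2 * q - (2 * i + 1)) *
      ((2 * q).choose (2 * i + 1) : ℝ) + (-b) ^ (2 * i + 1) * a ^ (2 * q - (2 * i + 1)) *
      ((2 * q).choose (2 * i + 1) : ℝ)) = 0 := by
    refine Finset.sum_eq_zero fun i _ => ?_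
    rw [Odd.neg_pow ⟨i, rfl⟩]
    ring
  rw [hodd, add_zero]
  refine Finset.sum_congr rfl fun i _ => ?_
  rw [Even.neg_pow ⟨i, by ring⟩, ← pow_mul, ← pow_mul, Nat.mul_sub]
  ring

lemma two_point (q : ℕ) (hq : 1 ≤ q) (a b : ℝ) :
    (a + b) ^ (2 * q) + (a - b) ^ (2 * q) ≤ 2 * (a ^ 2 + (2 * q - 1) * b ^ 2) ^ q := by
  rw [add_pow_add_sub_pow, add_comm (a ^ 2), add_pow]
  refine mul_le_mul_of_nonneg_left (Finset.sum_le_sum fun i _ => ?_) (by norm_num)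
  rw [mul_pow]
  have h := choose_cmp q i hq
  have h' : ((2 * q).choose (2 * i) : ℝ) ≤ q.choose i * (2 * q - 1 : ℝ) ^ i := by
    have : (((2 * q).choose (2 * i) : ℕ) : ℝ) ≤ ((q.choose i * (2 * q - 1) ^ i : ℕ) : ℝ) := by
      exact_mod_cast h
    rw [Nat.cast_mul, Nat.cast_pow, Nat.cast_sub (by omega)] at this
    push_cast at this
    exact this
  calc _ ≤ (q.choose i * (2 * q - 1 : ℝ) ^ i) * (b ^ 2) ^ i * (a ^ 2) ^ (q - i) := by gcongr
    _ = _ := by ring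

/-- Minkowski for natural powers, normalised. -/
lemma minkowski {ι : Type} [Fintype ι] (q : ℕ) (hq : 1 ≤ q) (F G : ι → ℝ)
    (hF : ∀ x, 0 ≤ F x) (hG : ∀ x, 0 ≤ G x) (N u w : ℝ) (hN : 0 ≤ N) (hu : 0 ≤ u) (hw : 0 ≤ w)
    (h1 : ∑ x, F x ^ q ≤ N * u ^ q) (h2 : ∑ x, G x ^ q ≤ N * w ^ q) :
    ∑ x, (F x + G x) ^ q ≤ N * (u + w) ^ q := by
  have hq0 : (q : ℝ) ≠ 0 := by positivity
  have hp : (1 : ℝ) ≤ q := by exact_mod_cast hq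
  have h := Real.Lp_add_le_of_nonneg (s := (univ : Finset ι)) (f := F) (g := G) hp
    (fun i _ => hF i) (fun i _ => hG i)
  simp only [Real.rpow_natCast] at h
  have aux : ∀ (S v : ℝ), 0 ≤ S → 0 ≤ v → S ≤ N * v ^ q →
      S ^ (1 / (q : ℝ)) ≤ N ^ (1 / (q : ℝ)) * v := by
    intro S v hS hv hSv
    calc S ^ (1 / (q : ℝ)) ≤ (N * v ^ q) ^ (1 / (q : ℝ)) :=
          Real.rpow_le_rpow hS hSv (by positivity)
      _ = _ := by
          rw [Real.mul_rpow hN (by positivity), one_div, Real.pow_rpow_inv_natCast hv (by omega)]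
  have hF' := aux _ u (Finset.sum_nonneg fun x _ => pow_nonneg (hF x) q) hu h1
  have hG' := aux _ w (Finset.sum_nonneg fun x _ => pow_nonneg (hG x) q) hw h2
  have hS0 : 0 ≤ ∑ x, (F x + G x) ^ q :=
    Finset.sum_nonneg fun x _ => pow_nonneg (add_nonneg (hF x) (hG x)) q
  have hfin : (∑ x, (F x + G x) ^ q) ^ (1 / (q : ℝ)) ≤ N ^ (1 / (q : ℝ)) * (u + w) := by
    linarith
  have := pow_le_pow_left₀ (Real.rpow_nonneg hS0 _) hfin q
  rw [mul_pow, one_div, Real.rpow_inv_natCast_pow hS0 (by omega),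
    Real.rpow_inv_natCast_pow hN (by omega)] at this
  exact this

/-- An adaptive exploration process. -/
structure Explore (n : ℕ) where
  P : ℕ → (Fin n → Bool) → Finset (Fin n)
  nxt : ℕ → (Fin n → Bool) → Option (Fin n)
  h0 : ∀ x, P 0 x = ∅
  hnone : ∀ t x, nxt t x = none → P (t + 1) x = P t x
  hnew : ∀ t x i, nxt t x = some i → i ∉ P t x
  hsome : ∀ t x i, nxt t x = some i → P (t + 1) x = insert i (P t x)
  hP : ∀ t x y, (∀ i ∈ P t x, y i = x i) → P t y = P t x
  hnxt : ∀ t x y, (∀ i ∈ P t x, y i = x i) → nxt t y = nxt t x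

namespace Explore

variable {n : ℕ} (E : Explore n)

noncomputable def M (a : Finset (Fin n) → ℝ) (j t : ℕ) (x : Fin n → Bool) : ℝ :=
  ∑ T ∈ powersetCard j (E.P t x), a T * chi T x

noncomputable def D (a : Finset (Fin n) → ℝ) (j t : ℕ) (x : Fin n → Bool) : ℝ :=
  match E.nxt t x with
  | none => 0
  | some i => E.M (fun T => a (insert i T)) j t x

def sig (t : ℕ) (x : Fin n → Bool) : Fin n → Bool :=
  match E.nxt t x with
  | none => x
  | some i => flip i x

lemma agree_flip {t : ℕ} {x : Fin n → Bool} {i : Fin n} (h : i ∉ E.P t x) :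
    ∀ k ∈ E.P t x, flip i x k = x k := fun k hk =>
  flip_of_ne x (fun e => h (e ▸ hk))

lemma M_flip (a : Finset (Fin n) → ℝ) (j : ℕ) {t : ℕ} {x : Fin n → Bool} {i : Fin n}
    (h : i ∉ E.P t x) : E.M a j t (flip i x) = E.M a j t x := by
  unfold M
  rw [E.hP t x _ (E.agree_flip h)]
  refine Finset.sum_congr rfl fun T hT => ?_
  rw [chi_flip_of_not_mem]
  exact fun hi => h ((Finset.mem_powersetCard.1 hT).1 hi)

lemma sig_sig (t : ℕ) (x : Fin n → Bool) : E.sig t (E.sig t x) = x := by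
  rcases h : E.nxt t x with _ | i
  · simp [sig, h]
  · have h2 : E.nxt t (flip i x) = some i := by
      rw [E.hnxt t x _ (E.agree_flip (E.hnew t x i h)), h]
    simp [sig, h, h2, flip_flip]

lemma M_succ_pair (a : Finset (Fin n) → ℝ) (j t : ℕ) (x : Fin n → Bool) :
    ∃ e : ℝ, e ^ 2 = 1 ∧ E.M a (j + 1) (t + 1) x = E.M a (j + 1) t x + e * E.D a j t x ∧
      E.M a (j + 1) (t + 1) (E.sig t x) = E.M a (j + 1) t x - e * E.D a j t x := by
  rcases h : E.nxt t x with _ | i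
  · refine ⟨1, by norm_num, ?_, ?_⟩
    · simp [D, h, M, E.hnone t x h]
    · simp [D, h, M, E.hnone t x h, sig]
  · have hi := E.hnew t x i h
    have hgen : ∀ y, E.nxt t y = some i → E.M a (j + 1) (t + 1) y = E.M a (j + 1) t y +
        (if y i then (1 : ℝ) else -1) * E.M (fun T => a (insert i T)) j t y := by
      intro y hy
      have hiy := E.hnew t y i hy
      unfold M
      rw [E.hsome t y i hy, Finset.powersetCard_succ_insert hiy, Finset.sum_union,
        Finset.sum_image, Finset.mul_sum]
      · congr 1
        refine Finset.sum_congr rfl fun T hT => ?_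
        rw [chi_insert _ (fun hh => hiy ((Finset.mem_powersetCard.1 hT).1 hh))]
        ring
      · intro S hS T hT hST
        have hS' : i ∉ S := fun hh => hiy ((Finset.mem_powersetCard.1 hS).1 hh)
        have hT' : i ∉ T := fun hh => hiy ((Finset.mem_powersetCard.1 hT).1 hh)
        rw [← Finset.erase_insert hS', ← Finset.erase_insert hT', hST]
      · rw [Finset.disjoint_left]
        intro S hS hS2
        obtain ⟨T, -, rfl⟩ := Finset.mem_image.1 hS2
        exact hiy ((Finset.mem_powersetCard.1 hS).1 (Finset.mem_insert_self i T))
    refine ⟨if x i then (1 : ℝ) else -1, by split_ifs <;> norm_num, ?_, ?_⟩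
    · rw [hgen x h]; simp [D, h]
    · have h2 : E.nxt t (flip i x) = some i := by
        rw [E.hnxt t x _ (E.agree_flip hi), h]
      have hs : E.sig t x = flip i x := by simp [sig, h]
      rw [hs, hgen _ h2, E.M_flip _ _ hi, E.M_flip _ _ hi, sgn_flip]
      simp only [D, h]
      ring

lemma step_sum (a : Finset (Fin n) → ℝ) (j t q : ℕ) (hq : 1 ≤ q) :
    ∑ x, E.M a (j + 1) (t + 1) x ^ (2 * q) ≤
      ∑ x, (E.M a (j + 1) t x ^ 2 + (2 * q - 1) * E.D a j t x ^ 2) ^ q := by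
  have hs : ∑ x, E.M a (j + 1) (t + 1) (E.sig t x) ^ (2 * q) =
      ∑ x, E.M a (j + 1) (t + 1) x ^ (2 * q) :=
    Equiv.sum_comp (Function.Involutive.toPerm (E.sig t) (E.sig_sig t))
      (fun x => E.M a (j + 1) (t + 1) x ^ (2 * q))
  have : ∑ x, (E.M a (j + 1) (t + 1) x ^ (2 * q) + E.M a (j + 1) (t + 1) (E.sig t x) ^ (2 * q)) ≤
      ∑ x, 2 * (E.M a (j + 1) t x ^ 2 + (2 * q - 1) * E.D a j t x ^ 2) ^ q := by
    refine Finset.sum_le_sum fun x _ => ?_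
    obtain ⟨e, he, h1, h2⟩ := E.M_succ_pair a j t x
    rw [h1, h2]
    have := two_point q hq (E.M a (j + 1) t x) (e * E.D a j t x)
    rw [mul_pow, he, one_mul] at this
    exact this
  rw [Finset.sum_add_distrib, hs, ← Finset.mul_sum] at this
  linarith

lemma step_bound (a : Finset (Fin n) → ℝ) (j t q : ℕ) (hq : 1 ≤ q) (N u w : ℝ) (hN : 0 ≤ N)
    (hu : 0 ≤ u) (hw : 0 ≤ w)
    (h1 : ∑ x, E.M a (j + 1) t x ^ (2 * q) ≤ N * u ^ q)
    (h2 : ∑ x, E.D a j t x ^ (2 * q) ≤ N * w ^ q) :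
    ∑ x, E.M a (j + 1) (t + 1) x ^ (2 * q) ≤ N * (u + (2 * q - 1) * w) ^ q := by
  have hq1 : (1 : ℝ) ≤ q := by exact_mod_cast hq
  have hq2 : (0 : ℝ) ≤ 2 * q - 1 := by linarith
  refine (E.step_sum a j t q hq).trans ?_
  refine minkowski q hq (fun x => E.M a (j + 1) t x ^ 2) (fun x => (2 * q - 1) * E.D a j t x ^ 2)
    (fun x => by positivity) (fun x => by positivity) N u _ hN hu (by positivity) ?_ ?_
  · simpa only [← pow_mul] using h1
  · simp only [mul_pow, ← pow_mul, ← Finset.mul_sum]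
    calc _ ≤ (2 * q - 1 : ℝ) ^ q * (N * w ^ q) := by gcongr
      _ = _ := by ring

lemma D_bound (a : Finset (Fin n) → ℝ) (j t q : ℕ) (B : ℝ) (hB : 0 ≤ B)
    (h : ∀ i, ∑ x, E.M (fun T => a (insert i T)) j t x ^ (2 * q) ≤ B) (hq : 1 ≤ q) :
    ∑ x, E.D a j t x ^ (2 * q) ≤ n * B := by
  calc ∑ x, E.D a j t x ^ (2 * q)
      ≤ ∑ x, ∑ i, E.M (fun T => a (insert i T)) j t x ^ (2 * q) := by
        refine Finset.sum_le_sum fun x _ => ?_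
        have hnn : ∀ i ∈ (univ : Finset (Fin n)),
            0 ≤ E.M (fun T => a (insert i T)) j t x ^ (2 * q) := fun i _ => by
          rw [pow_mul]; positivity
        rcases hx : E.nxt t x with _ | i
        · simp only [D, hx]
          rw [zero_pow (by omega)]
          exact Finset.sum_nonneg hnn
        · simp only [D, hx]
          exact Finset.single_le_sum hnn (Finset.mem_univ i)
    _ = ∑ i, ∑ x, E.M (fun T => a (insert i T)) j t x ^ (2 * q) := Finset.sum_comm
    _ ≤ ∑ i : Fin n, B := Finset.sum_le_sum fun i _ => h i
    _ = n * B := by simp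

lemma M_zero_sq (a : Finset (Fin n) → ℝ) (ha : ∀ S, |a S| ≤ 1) (t : ℕ) (x : Fin n → Bool) :
    E.M a 0 t x ^ 2 ≤ 1 := by
  have := ha ∅
  simp only [M, Finset.powersetCard_zero, Finset.sum_singleton, chi, Finset.prod_empty, mul_one]
  rw [← sq_abs]
  nlinarith [abs_nonneg (a ∅)]

lemma moment (q : ℕ) (hq : 1 ≤ q) (c : ℝ) (hc : 0 ≤ c) (hn : (n : ℝ) ≤ c ^ q) (j : ℕ) :
    ∀ (a : Finset (Fin n) → ℝ), (∀ S, |a S| ≤ 1) → ∀ t,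
      ∑ x, E.M a j t x ^ (2 * q) ≤
        (2 : ℝ) ^ n * ((t.choose j : ℝ) * ((2 * q - 1) * c) ^ j) ^ q := by
  have hq1 : (1 : ℝ) ≤ q := by exact_mod_cast hq
  have hq2 : (0 : ℝ) ≤ 2 * q - 1 := by linarith
  induction j with
  | zero =>
    intro a ha t
    calc ∑ x, E.M a 0 t x ^ (2 * q) ≤ ∑ x : Fin n → Bool, (1 : ℝ) := by
          refine Finset.sum_le_sum fun x _ => ?_
          rw [pow_mul]
          exact pow_le_one₀ (sq_nonneg _) (E.M_zero_sq a ha t x)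
      _ = _ := by simp
  | succ j ih =>
    intro a ha t
    induction t with
    | zero =>
      have : ∀ x, E.M a (j + 1) 0 x = 0 := by
        intro x
        simp only [M, E.h0]
        rw [Finset.powersetCard_eq_empty.2 (by simp), Finset.sum_empty]
      simp only [this]
      rw [zero_pow (by omega)]
      simp
    | succ t iht =>
      have hD := E.D_bound a j t q _ (by positivity) (fun i => ih _ (fun S => ha _) t) hq
      have hD' : ∑ x, E.D a j t x ^ (2 * q) ≤
          (2 : ℝ) ^ n * (c * ((t.choose j : ℝ) * ((2 * q - 1) * c) ^ j)) ^ q := by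
        refine hD.trans ?_
        rw [mul_pow c]
        calc _ ≤ c ^ q * ((2 : ℝ) ^ n * ((t.choose j : ℝ) * ((2 * q - 1) * c) ^ j) ^ q) := by
              gcongr
          _ = _ := by ring
      refine (E.step_bound a j t q hq _ _ _ (by positivity) (by positivity) (by positivity)
        iht hD').trans (le_of_eq ?_)
      rw [Nat.choose_succ_succ]
      push_cast
      ring

lemma second_moment (a : Finset (Fin n) → ℝ) (j : ℕ) (W : ℝ) (hW : 0 ≤ W)
    (hD : ∀ t, ∑ x, E.D a j t x ^ 2 ≤ (2 : ℝ) ^ n * ((t.choose j : ℝ) * W)) (t : ℕ) :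
    ∑ x, E.M a (j + 1) t x ^ 2 ≤ (2 : ℝ) ^ n * ((t.choose (j + 1) : ℝ) * W) := by
  induction t with
  | zero =>
    have : ∀ x, E.M a (j + 1) 0 x = 0 := by
      intro x
      simp only [M, E.h0]
      rw [Finset.powersetCard_eq_empty.2 (by simp), Finset.sum_empty]
    simp [this]
  | succ t ih =>
    have := E.step_bound a j t 1 le_rfl (2 ^ n) ((t.choose (j + 1) : ℝ) * W)
      ((t.choose j : ℝ) * W) (by positivity) (by positivity) (by positivity)
      (by simpa using ih) (by simpa using hD t)
    simp only [mul_one, pow_one] at this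
    refine this.trans (le_of_eq ?_)
    rw [Nat.choose_succ_succ]
    push_cast
    ring

lemma power_mean {ι : Type} [Fintype ι] (q : ℕ) (hq : 1 ≤ q) (F : ι → ℝ)
    (hF : ∀ x, 0 ≤ F x) (w : ℝ) (hw : 0 ≤ w)
    (h : ∑ x, F x ^ q ≤ (Fintype.card ι : ℝ) * w ^ q) :
    ∑ x, F x ≤ (Fintype.card ι : ℝ) * w := by
  obtain ⟨m, rfl⟩ : ∃ m, q = m + 1 := ⟨q - 1, by omega⟩
  rcases isEmpty_or_nonempty ι with he | hne
  · simp
  have hc : (0 : ℝ) < Fintype.card ι := by exact_mod_cast Fintype.card_pos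
  have h1 := pow_sum_div_card_le_sum_pow (s := (univ : Finset ι)) (f := F) (fun i _ => hF i) m
  rw [div_le_iff₀ (by simpa using pow_pos hc m), Finset.card_univ] at h1
  refine le_of_pow_le_pow_left₀ (n := m + 1) (by omega) (by positivity) (h1.trans ?_)
  calc _ ≤ ((Fintype.card ι : ℝ) * w ^ (m + 1)) * (Fintype.card ι : ℝ) ^ m := by gcongr
    _ = _ := by ring

lemma D_second (q : ℕ) (hq : 1 ≤ q) (c : ℝ) (hc : 1 ≤ c) (hn : (n : ℝ) ≤ c ^ q) (j : ℕ)
    (a : Finset (Fin n) → ℝ) (ha : ∀ S, |a S| ≤ 1) (t : ℕ) :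
    ∑ x, E.D a j t x ^ 2 ≤
      (2 : ℝ) ^ n * ((t.choose j : ℝ) * ((2 * q - 1) * c ^ 2) ^ j) := by
  have hq1 : (1 : ℝ) ≤ q := by exact_mod_cast hq
  have hq2 : (0 : ℝ) ≤ 2 * q - 1 := by linarith
  have hc0 : 0 ≤ c := by linarith
  rcases Nat.eq_zero_or_pos j with rfl | hj
  · calc ∑ x, E.D a 0 t x ^ 2 ≤ ∑ x : Fin n → Bool, (1 : ℝ) := by
          refine Finset.sum_le_sum fun x _ => ?_
          rcases hx : E.nxt t x with _ | i
          · simp [D, hx]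
          · simp only [D, hx]
            exact E.M_zero_sq _ (fun S => ha _) t x
      _ = _ := by simp
  · have hD := E.D_bound a j t q _ (by positivity)
      (fun i => E.moment q hq c hc0 hn j _ (fun S => ha _) t) hq
    have hD' : ∑ x, (E.D a j t x ^ 2) ^ q ≤ (Fintype.card (Fin n → Bool) : ℝ) *
        (c * ((t.choose j : ℝ) * ((2 * q - 1) * c) ^ j)) ^ q := by
      simp only [← pow_mul]
      refine hD.trans ?_
      rw [mul_pow c]
      calc _ ≤ c ^ q * ((2 : ℝ) ^ n * ((t.choose j : ℝ) * ((2 * q - 1) * c) ^ j) ^ q) := by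
            gcongr
        _ = _ := by simp; ring
    have := power_mean q hq _ (fun x => sq_nonneg _) _ (by positivity) hD'
    refine this.trans ?_
    have hcard : (Fintype.card (Fin n → Bool) : ℝ) = 2 ^ n := by simp
    rw [hcard]
    have hcj : c ≤ c ^ j := le_self_pow₀ hc (by omega)
    calc (2 : ℝ) ^ n * (c * ((t.choose j : ℝ) * ((2 * q - 1) * c) ^ j))
        ≤ (2 : ℝ) ^ n * (c ^ j * ((t.choose j : ℝ) * ((2 * q - 1) * c) ^ j)) := by gcongr
      _ = _ := by
        rw [mul_pow _ c j, mul_pow _ (c ^ 2) j]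
        ring

end Explore

/-! ### The exploration of a decision tree -/

def stepT {n : ℕ} (x : Fin n → Bool) : DTree (Fin n) → DTree (Fin n)
  | .leaf b => .leaf b
  | .node i t0 t1 => if x i then t1 else t0

def ins {n : ℕ} : DTree (Fin n) → Finset (Fin n) → Finset (Fin n)
  | .leaf _, P => P
  | .node i _ _, P => insert i P

def nx {n : ℕ} : DTree (Fin n) → Finset (Fin n) → Option (Fin n)
  | .leaf _, _ => none
  | .node i _ _, P => if i ∈ P then none else some i

def cur {n : ℕ} (T : DTree (Fin n)) (x : Fin n → Bool) : ℕ → DTree (Fin n)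
  | 0 => T
  | t + 1 => stepT x (cur T x t)

def PT {n : ℕ} (T : DTree (Fin n)) (x : Fin n → Bool) : ℕ → Finset (Fin n)
  | 0 => ∅
  | t + 1 => ins (cur T x t) (PT T x t)

lemma cur_agree {n : ℕ} (T : DTree (Fin n)) (x y : Fin n → Bool) (t : ℕ) :
    (∀ i ∈ PT T x t, y i = x i) → PT T y t = PT T x t ∧ cur T y t = cur T x t := by
  induction t with
  | zero => intro _; exact ⟨rfl, rfl⟩
  | succ t ih =>
    intro h
    have hsub : PT T x t ⊆ PT T x (t + 1) := by
      simp only [PT]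
      cases cur T x t with
      | leaf b => exact Finset.Subset.refl _
      | node i a b => exact Finset.subset_insert _ _
    obtain ⟨h1, h2⟩ := ih fun i hi => h i (hsub hi)
    refine ⟨by simp only [PT, h1, h2], ?_⟩
    simp only [cur, h2]
    simp only [PT] at h
    cases hc : cur T x t with
    | leaf b => rfl
    | node i a b =>
      rw [hc] at h
      simp only [stepT, h i (Finset.mem_insert_self _ _)]

def explore {n : ℕ} (T : DTree (Fin n)) : Explore n where
  P t x := PT T x t
  nxt t x := nx (cur T x t) (PT T x t)
  h0 _ := rfl
  hnone t x h := by
    simp only [PT]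
    cases hc : cur T x t with
    | leaf b => rfl
    | node i a b =>
      rw [hc] at h
      by_cases hi : i ∈ PT T x t
      · simp [ins, hi]
      · simp [nx, hi] at h
  hnew t x i h := by
    cases hc : cur T x t with
    | leaf b => simp [hc, nx] at h
    | node k a b =>
      rw [hc] at h
      by_cases hi : k ∈ PT T x t
      · simp [nx, hi] at h
      · simp [nx, hi] at h
        exact h ▸ hi
  hsome t x i h := by
    simp only [PT]
    cases hc : cur T x t with
    | leaf b => simp [hc, nx] at h
    | node k a b =>
      rw [hc] at h
      by_cases hi : k ∈ PT T x t
      · simp [nx, hi] at h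
      · simp [nx, hi] at h
        simp [ins, h]
  hP t x y h := (cur_agree T x y t h).1
  hnxt t x y h := by
    obtain ⟨h1, h2⟩ := cur_agree T x y t h
    simp only [h1, h2]

lemma eval_cur {n : ℕ} (T : DTree (Fin n)) (x : Fin n → Bool) (t : ℕ) :
    (cur T x t).eval x = T.eval x := by
  induction t with
  | zero => rfl
  | succ t ih =>
    rw [← ih]
    simp only [cur]
    cases cur T x t with
    | leaf b => rfl
    | node i a b =>
      simp only [stepT, DTree.eval]
      split_ifs <;> rfl

lemma depth_cur {n : ℕ} (T : DTree (Fin n)) (x : Fin n → Bool) (t : ℕ) :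
    (cur T x t).depth ≤ T.depth - t := by
  induction t with
  | zero => simp [cur]
  | succ t ih =>
    simp only [cur]
    cases hc : cur T x t with
    | leaf b => simp [stepT, DTree.depth]
    | node i a b =>
      rw [hc] at ih
      simp only [DTree.depth] at ih
      simp only [stepT]
      split_ifs <;> omega

lemma eval_agree {n : ℕ} (T : DTree (Fin n)) (d : ℕ) (hd : T.depth ≤ d) (x y : Fin n → Bool)
    (h : ∀ i ∈ PT T x d, y i = x i) : T.eval y = T.eval x := by
  rw [← eval_cur T y d, ← eval_cur T x d, (cur_agree T x y d h).2]
  have := depth_cur T x d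
  cases hc : cur T x d with
  | leaf b => rfl
  | node i a b =>
    rw [hc] at this
    simp only [DTree.depth] at this
    omega

lemma eval_sq {n : ℕ} (T : DTree (Fin n)) (x : Fin n → Bool) : T.eval x ^ 2 ≤ 1 := by
  induction T with
  | leaf b => cases b <;> simp [DTree.eval]
  | node i a b iha ihb =>
    simp only [DTree.eval]
    split_ifs
    · exact ihb
    · exact iha

/-- Characters not contained in the explored set do not contribute. -/
lemma sum_outside {n : ℕ} (T : DTree (Fin n)) (d : ℕ) (hd : T.depth ≤ d) (S : Finset (Fin n)) :
    ∑ x, T.eval x * chi S x = ∑ x, (if S ⊆ PT T x d then T.eval x * chi S x else 0) := by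
  classical
  rw [← sub_eq_zero, ← Finset.sum_sub_distrib]
  have hrw : ∀ x, (T.eval x * chi S x - (if S ⊆ PT T x d then T.eval x * chi S x else 0)) =
      if (S \ PT T x d).Nonempty then T.eval x * chi S x else 0 := by
    intro x
    by_cases h : S ⊆ PT T x d
    · have : ¬ (S \ PT T x d).Nonempty := by
        rw [Finset.not_nonempty_iff_eq_empty, Finset.sdiff_eq_empty_iff_subset]; exact h
      simp [h]
    · have : (S \ PT T x d).Nonempty := by
        rw [Finset.nonempty_iff_ne_empty, Ne, Finset.sdiff_eq_empty_iff_subset]; exact h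
      simp [h]
  simp only [hrw]
  let τ : (Fin n → Bool) → (Fin n → Bool) := fun x =>
    if h : (S \ PT T x d).Nonempty then flip ((S \ PT T x d).min' h) x else x
  have hPτ : ∀ x, (PT T (τ x) d = PT T x d) ∧ T.eval (τ x) = T.eval x := by
    intro x
    by_cases h : (S \ PT T x d).Nonempty
    · have hm := Finset.min'_mem _ h
      have hag : ∀ i ∈ PT T x d, τ x i = x i := by
        intro i hi
        simp only [τ, dif_pos h]
        exact flip_of_ne x (fun e => (Finset.mem_sdiff.1 hm).2 (e ▸ hi))
      exact ⟨(cur_agree T x _ d hag).1, eval_agree T d hd x _ hag⟩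
    · simp [τ, h]
  have hinv : ∀ x, τ (τ x) = x := by
    intro x
    by_cases h : (S \ PT T x d).Nonempty
    · have h1 : τ x = flip ((S \ PT T x d).min' h) x := by simp only [τ, dif_pos h]
      have h2 : τ (τ x) = flip ((S \ PT T x d).min' h) (τ x) := by
        have hP := (hPτ x).1
        generalize τ x = y at *
        simp only [τ, hP, dif_pos h]
      rw [h2, h1, flip_flip]
    · have h1 : τ x = x := by simp only [τ, dif_neg h]
      rw [h1, h1]
  have hs : ∑ x, (if (S \ PT T (τ x) d).Nonempty then T.eval (τ x) * chi S (τ x) else 0) =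
      ∑ x, (if (S \ PT T x d).Nonempty then T.eval x * chi S x else 0) :=
    Equiv.sum_comp (Function.Involutive.toPerm τ hinv)
    (fun x => if (S \ PT T x d).Nonempty then T.eval x * chi S x else 0)
  have hneg : ∀ x, (if (S \ PT T (τ x) d).Nonempty then T.eval (τ x) * chi S (τ x) else 0) =
      - (if (S \ PT T x d).Nonempty then T.eval x * chi S x else 0) := by
    intro x
    rw [(hPτ x).1, (hPτ x).2]
    by_cases h : (S \ PT T x d).Nonempty
    · have h1 : τ x = flip ((S \ PT T x d).min' h) x := by simp only [τ, dif_pos h]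
      rw [if_pos h, if_pos h, h1, chi_flip_of_mem]
      · ring
      · exact (Finset.mem_sdiff.1 (Finset.min'_mem _ h)).1
    · simp [h]
  simp only [hneg, Finset.sum_neg_distrib] at hs
  linarith

lemma level_bound {n : ℕ} (T : DTree (Fin n)) (d j : ℕ) (hd : T.depth ≤ d)
    (q : ℕ) (hq : 1 ≤ q) (c : ℝ) (hc : 1 ≤ c) (hn : (n : ℝ) ≤ c ^ q) :
    ∑ S ∈ Finset.univ.filter (fun S : Finset (Fin n) => S.card = j + 1),
      |booleanFourierCoeff (fun x => T.eval x) S| ≤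
    Real.sqrt ((d.choose (j + 1) : ℝ) * ((2 * q - 1) * c ^ 2) ^ j) := by
  have hq1 : (1 : ℝ) ≤ q := by exact_mod_cast hq
  have hq2 : (0 : ℝ) ≤ 2 * q - 1 := by linarith
  set a : Finset (Fin n) → ℝ := fun S =>
    if 0 ≤ booleanFourierCoeff (fun x => T.eval x) S then 1 else -1 with ha_def
  have ha : ∀ S, |a S| ≤ 1 := by
    intro S
    simp only [ha_def]
    split_ifs <;> simp
  have habs : ∀ S, |booleanFourierCoeff (fun x => T.eval x) S| =
      a S * booleanFourierCoeff (fun x => T.eval x) S := by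
    intro S
    simp only [ha_def]
    split_ifs with h
    · rw [abs_of_nonneg h, one_mul]
    · rw [abs_of_neg (not_le.1 h)]; ring
  set E := explore T
  have hsum : ∑ S ∈ Finset.univ.filter (fun S : Finset (Fin n) => S.card = j + 1),
      |booleanFourierCoeff (fun x => T.eval x) S| =
      (∑ x, T.eval x * E.M a (j + 1) d x) / 2 ^ n := by
    rw [Finset.sum_div]
    have h1 : ∀ S : Finset (Fin n), |booleanFourierCoeff (fun x => T.eval x) S| =
        ∑ x, (if S ⊆ PT T x d then T.eval x * (a S * chi S x) / 2 ^ n else 0) := by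
      intro S
      have := sum_outside T d hd S
      rw [habs]
      unfold booleanFourierCoeff
      rw [Fintype.card_fin]
      unfold chi at this ⊢
      rw [this, Finset.sum_div, Finset.mul_sum]
      refine Finset.sum_congr rfl fun x _ => ?_
      split_ifs
      · ring
      · simp
    rw [Finset.sum_congr rfl fun S _ => h1 S]
    rw [Finset.sum_comm]
    refine Finset.sum_congr rfl fun x _ => ?_
    rw [← Finset.sum_filter, ← Finset.sum_div, ← Finset.mul_sum]
    congr 2
    unfold Explore.M
    refine Finset.sum_congr ?_ fun _ _ => rfl
    ext S
    simp only [Finset.mem_filter, Finset.mem_univ, true_and, Finset.mem_powersetCard]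
    exact and_comm
  rw [hsum]
  apply Real.le_sqrt_of_sq_le
  have hM := E.second_moment a j _ (by positivity)
    (fun t => E.D_second q hq c hc hn j a ha t) d
  have hcs := Finset.sum_mul_sq_le_sq_mul_sq (univ : Finset (Fin n → Bool))
    (fun x => T.eval x) (fun x => E.M a (j + 1) d x)
  have hT : ∑ x : Fin n → Bool, T.eval x ^ 2 ≤ 2 ^ n := by
    calc ∑ x : Fin n → Bool, T.eval x ^ 2 ≤ ∑ x : Fin n → Bool, (1 : ℝ) :=
          Finset.sum_le_sum fun x _ => eval_sq T x
      _ = _ := by simp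
  rw [div_pow, div_le_iff₀ (by positivity)]
  calc _ ≤ _ := hcs
    _ ≤ (2 : ℝ) ^ n * ((2 : ℝ) ^ n * ((d.choose (j + 1) : ℝ) * ((2 * q - 1) * c ^ 2) ^ j)) := by
        gcongr
    _ = _ := by ring

end LevelIneq

/-- there is a universal constant `C > 0` such that for every
`n ≥ 2`, every Boolean function `f : {-1,1}^n → {0,1}` computed by a decision
tree of depth at most `d`, and every `1 ≤ ℓ ≤ d`,
`∑_{|S|=ℓ} |f̂(S)| ≤ √(d^ℓ · (C·ln n)^{ℓ-1})`. -/
theorem level_l_inequality_decision_trees_log_form :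
    ∃ C : ℝ, 0 < C ∧
      ∀ (n d ℓ : ℕ) (f : (Fin n → Bool) → ℝ) (T : DTree (Fin n)),
        2 ≤ n → T.depth ≤ d → (∀ x, f x = T.eval x) →
        1 ≤ ℓ → ℓ ≤ d →
        ∑ S ∈ Finset.univ.filter (fun S : Finset (Fin n) => S.card = ℓ),
            |booleanFourierCoeff f S| ≤
          Real.sqrt ((d : ℝ) ^ ℓ * (C * Real.log n) ^ (ℓ - 1)) := by
  refine ⟨100, by norm_num, ?_⟩
  intro n d ℓ f T hn hd hf hl _
  obtain ⟨j, rfl⟩ : ∃ j, ℓ = j + 1 := ⟨ℓ - 1, by omega⟩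
  have hf' : f = fun x => T.eval x := funext hf
  subst hf'
  have hn2 : (2 : ℝ) ≤ n := by exact_mod_cast hn
  have hlog2 : Real.log 2 ≤ Real.log n := Real.log_le_log (by norm_num) hn2
  have hl2 := Real.log_two_gt_d9
  have hlogpos : 0 < Real.log n := by linarith
  set q := ⌈Real.log n⌉₊ with hq_def
  have hq : 1 ≤ q := Nat.one_le_ceil_iff.2 hlogpos
  have hq1 : (1 : ℝ) ≤ q := by exact_mod_cast hq
  have hq2 : (0 : ℝ) ≤ 2 * q - 1 := by linarith
  have hqle : Real.log n ≤ q := Nat.le_ceil _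
  have hqlt : (q : ℝ) < Real.log n + 1 := Nat.ceil_lt_add_one hlogpos.le
  have he1 : (1 : ℝ) ≤ Real.exp 1 := Real.one_le_exp (by norm_num)
  have he2 : Real.exp 1 ^ 2 ≤ 9 := by
    have := Real.exp_one_lt_d9
    nlinarith
  have hnq : (n : ℝ) ≤ Real.exp 1 ^ q := by
    rw [← Real.exp_nat_mul, mul_one]
    calc (n : ℝ) = Real.exp (Real.log n) := (Real.exp_log (by linarith)).symm
      _ ≤ _ := Real.exp_le_exp.2 hqle
  refine (LevelIneq.level_bound T d j hd q hq (Real.exp 1) he1 hnq).trans ?_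
  apply Real.sqrt_le_sqrt
  rw [Nat.add_sub_cancel]
  have hch : (d.choose (j + 1) : ℝ) ≤ (d : ℝ) ^ (j + 1) := by
    exact_mod_cast Nat.choose_le_pow d (j + 1)
  have hK : (2 * (q : ℝ) - 1) * Real.exp 1 ^ 2 ≤ 100 * Real.log n := by
    calc (2 * (q : ℝ) - 1) * Real.exp 1 ^ 2 ≤ (2 * (q : ℝ) - 1) * 9 := by gcongr
      _ ≤ _ := by linarith
  gcongr
end

section
/- Let U ∈ ℝ^{N×N} be an orthogonal matrix and let k ≥ 1. For z = (z^{(1)},…,z^{(k)}) chosen uniformly at random from ({-1,1}^N)^k, the expectation of φ_U(z^{(1)},…,z^{(k)}) is 0, and the expectation of φ_U(z^{(1)},…,z^{(k)})² is 1/N. -/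
open scoped BigOperators

/-- `U : Fin N → Fin N → ℝ` (viewed as an `N × N` real matrix `U i j`) is
orthogonal: its columns and its rows are orthonormal. -/
def IsOrthogonal {N : ℕ} (U : Fin N → Fin N → ℝ) : Prop :=
  (∀ j₁ j₂ : Fin N, ∑ i, U i j₁ * U i j₂ = if j₁ = j₂ then (1 : ℝ) else 0) ∧
  (∀ i₁ i₂ : Fin N, ∑ j, U i₁ j * U i₂ j = if i₁ = i₂ then (1 : ℝ) else 0)

/-- The `k`-fold Rorrelation of the vectors `z 0, …, z (k-1)` in `ℝ^N` with
respect to the matrix `U`: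
`φ_U(z) = (1/N) ∑_{i₁,…,i_k} z^{(1)}_{i₁} U_{i₁ i₂} z^{(2)}_{i₂} ⋯ U_{i_{k-1} i_k} z^{(k)}_{i_k}`. -/
noncomputable def phiU (N k : ℕ) (U : Fin N → Fin N → ℝ)
    (z : Fin k → Fin N → ℝ) : ℝ :=
  (1 / N) * ∑ i : Fin k → Fin N,
    (∏ a : Fin k, z a (i a)) *
      ∏ b : Fin (k - 1),
        U (i ⟨b.val, lt_of_lt_of_le b.isLt (Nat.sub_le k 1)⟩)
          (i ⟨b.val + 1, by have := b.isLt; omega⟩)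


lemma aux_sum_one {N : ℕ} (p : Fin N) :
    ∑ w : Fin N → Bool, (if w p then (1:ℝ) else -1) = 0 := by
  have h : ∀ w : Fin N → Bool, (if w p then (1:ℝ) else -1)
      = ∏ j, (if j = p then (if w j then (1:ℝ) else -1) else 1) := by
    intro w
    rw [Finset.prod_ite_eq' Finset.univ p]
    simp
  rw [Finset.sum_congr rfl (fun w _ => h w)]
  rw [← Fintype.prod_sum (fun (j : Fin N) (b : Bool) =>
    (if j = p then (if b then (1:ℝ) else -1) else 1))]
  apply Finset.prod_eq_zero (Finset.mem_univ p)
  simp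

lemma aux_sum_two {N : ℕ} (p q : Fin N) :
    ∑ w : Fin N → Bool, (if w p then (1:ℝ) else -1) * (if w q then (1:ℝ) else -1)
      = if p = q then 2 ^ N else 0 := by
  split_ifs with hpq
  · subst hpq
    have h : ∀ w : Fin N → Bool,
        (if w p then (1:ℝ) else -1) * (if w p then (1:ℝ) else -1) = 1 := by
      intro w
      split_ifs <;> norm_num
    rw [Finset.sum_congr rfl (fun w _ => h w)]
    simp
  · have h : ∀ w : Fin N → Bool,
        (if w p then (1:ℝ) else -1) * (if w q then (1:ℝ) else -1)
        = ∏ j, ((if j = p then (if w j then (1:ℝ) else -1) else 1) *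
            (if j = q then (if w j then (1:ℝ) else -1) else 1)) := by
      intro w
      rw [Finset.prod_mul_distrib, Finset.prod_ite_eq' Finset.univ p,
        Finset.prod_ite_eq' Finset.univ q]
      simp
    rw [Finset.sum_congr rfl (fun w _ => h w)]
    rw [← Fintype.prod_sum (fun (j : Fin N) (b : Bool) =>
      ((if j = p then (if b then (1:ℝ) else -1) else 1) *
            (if j = q then (if b then (1:ℝ) else -1) else 1)))]
    apply Finset.prod_eq_zero (Finset.mem_univ p)
    simp [hpq]

lemma aux_path {N : ℕ} (U : Fin N → Fin N → ℝ)
    (hU : ∀ i, ∑ j, U i j * U i j = 1) (m : ℕ) :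
    ∑ i : Fin (m + 1) → Fin N, ∏ b : Fin m, U (i b.castSucc) (i b.succ) ^ 2 = N := by
  induction m with
  | zero => simp
  | succ m ih =>
    rw [← (Fin.snocEquiv (fun _ : Fin (m + 1 + 1) => Fin N)).sum_comp, Fintype.sum_prod_type,
      Finset.sum_comm, ← ih]
    refine Finset.sum_congr rfl fun i _ => ?_
    have h : ∀ x : Fin N, ∏ b : Fin (m + 1),
        U (Fin.snocEquiv (fun _ : Fin (m + 1 + 1) => Fin N) (x, i) b.castSucc)
          (Fin.snocEquiv (fun _ : Fin (m + 1 + 1) => Fin N) (x, i) b.succ) ^ 2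
        = (∏ b : Fin m, U (i b.castSucc) (i b.succ) ^ 2) *
            (U (i (Fin.last m)) x * U (i (Fin.last m)) x) := by
      intro x
      rw [Fin.prod_univ_castSucc]
      simp only [Fin.snocEquiv_apply, Fin.snoc_castSucc, Fin.succ_castSucc, Fin.succ_last,
        Fin.snoc_last, pow_two]
    rw [Finset.sum_congr rfl (fun x _ => h x), ← Finset.mul_sum, hU, mul_one]

lemma aux_phi (N m : ℕ) (U : Fin N → Fin N → ℝ) (z : Fin (m + 1) → Fin N → ℝ) :
    phiU N (m + 1) U z = (1 / N) * ∑ i : Fin (m + 1) → Fin N,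
      (∏ a, z a (i a)) * ∏ b : Fin m, U (i b.castSucc) (i b.succ) := rfl

/-- for an orthogonal `U ∈ ℝ^{N×N}` and `k ≥ 1`, when
`z = (z^{(1)},…,z^{(k)})` is uniform over `({-1,1}^N)^k` (encoded by Booleans,
`true ↦ 1`, `false ↦ -1`), `E[φ_U(z)] = 0` and `E[φ_U(z)²] = 1/N`. -/
theorem rorrelation_uniform_moments (N k : ℕ) (hk : 1 ≤ k)
    (U : Fin N → Fin N → ℝ) (hU : IsOrthogonal U) :
    (∑ z : Fin k → Fin N → Bool,
        phiU N k U (fun a j => if z a j then 1 else -1)) / 2 ^ (k * N) = 0 ∧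
    (∑ z : Fin k → Fin N → Bool,
        (phiU N k U (fun a j => if z a j then 1 else -1)) ^ 2) / 2 ^ (k * N)
      = 1 / N := by
  obtain ⟨m, rfl⟩ : ∃ m, k = m + 1 := ⟨k - 1, by omega⟩
  simp only [aux_phi]
  constructor
  · rw [← Finset.mul_sum, Finset.sum_comm, Finset.sum_eq_zero, mul_zero, zero_div]
    intro i _
    rw [← Finset.sum_mul, ← Fintype.prod_sum (fun (a : Fin (m + 1)) (w : Fin N → Bool) =>
      (if w (i a) then (1:ℝ) else -1))]
    simp [aux_sum_one]
  · have key : ∀ i j : Fin (m + 1) → Fin N, ∑ z : Fin (m + 1) → Fin N → Bool,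
        (∏ a, (if z a (i a) then (1:ℝ) else -1)) * (∏ a, (if z a (j a) then (1:ℝ) else -1))
        = if i = j then 2 ^ ((m + 1) * N) else 0 := by
      intro i j
      simp only [← Finset.prod_mul_distrib]
      rw [← Fintype.prod_sum (fun (a : Fin (m + 1)) (w : Fin N → Bool) =>
        (if w (i a) then (1:ℝ) else -1) * (if w (j a) then (1:ℝ) else -1))]
      simp only [aux_sum_two]
      split_ifs with h
      · subst h
        simp [← pow_mul, mul_comm]
      · obtain ⟨a, ha⟩ := Function.ne_iff.mp h
        exact Finset.prod_eq_zero (Finset.mem_univ a) (if_neg ha)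
    have hpath := aux_path U (fun i => by simpa using hU.2 i i) m
    have main : ∑ z : Fin (m + 1) → Fin N → Bool, (∑ i : Fin (m + 1) → Fin N,
        (∏ a, (if z a (i a) then (1:ℝ) else -1)) *
          ∏ b : Fin m, U (i b.castSucc) (i b.succ)) ^ 2 = 2 ^ ((m + 1) * N) * N := by
      simp only [pow_two, Finset.sum_mul_sum]
      rw [Finset.sum_comm, ← hpath, Finset.mul_sum]
      refine Finset.sum_congr rfl fun i _ => ?_
      rw [Finset.sum_comm]
      have h : ∀ j : Fin (m + 1) → Fin N, ∑ z : Fin (m + 1) → Fin N → Bool,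
          ((∏ a, (if z a (i a) then (1:ℝ) else -1)) *
            ∏ b : Fin m, U (i b.castSucc) (i b.succ)) *
          ((∏ a, (if z a (j a) then (1:ℝ) else -1)) *
            ∏ b : Fin m, U (j b.castSucc) (j b.succ))
          = (if i = j then 2 ^ ((m + 1) * N) else 0) *
            ((∏ b : Fin m, U (i b.castSucc) (i b.succ)) *
              ∏ b : Fin m, U (j b.castSucc) (j b.succ)) := by
        intro j
        rw [← key, Finset.sum_mul]
        exact Finset.sum_congr rfl fun z _ => by ring
      rw [Finset.sum_congr rfl (fun j _ => h j)]
      simp [Finset.prod_pow, pow_two, Finset.prod_mul_distrib]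
    simp only [mul_pow]
    rw [← Finset.mul_sum, main]
    rcases Nat.eq_zero_or_pos N with h0 | h0
    · subst h0
      simp
    · have : (N : ℝ) ≠ 0 := by positivity
      field_simp
end

section
/- Let U ∈ ℝ^{N×N} be an orthogonal matrix and k ≥ 2. Let X^{(1)},…,X^{(k-1)} be independent standard Gaussian vectors in ℝ^N (i.i.d. N(0,1) coordinates), let Y^{(i)} = Uᵀ·X^{(i)}, and define Z^{(1)} = X^{(1)}, Z^{(i)} = Y^{(i-1)} ⊙ X^{(i)} (entrywise product) for 2 ≤ i ≤ k-1, and Z^{(k)} = Y^{(k-1)}. Then E[ φ_U( sgn(Z^{(1)}), …, sgn(Z^{(k)}) ) ] ≥ (2/π)^{k-1}, where sgn is applied coordinatewise. -/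
open scoped BigOperators
open MeasureTheory

/-- The sign function into `{-1,1}`: `sgn t = 1` if `t ≥ 0`, and `-1` otherwise. -/
noncomputable def sgn (t : ℝ) : ℝ := if 0 ≤ t then 1 else -1

/-- The standard Gaussian measure on `ℝ^N`. -/
noncomputable def stdGaussianVec (N : ℕ) : MeasureTheory.Measure (Fin N → ℝ) :=
  MeasureTheory.Measure.pi fun _ => ProbabilityTheory.gaussianReal 0 1

/-- The law of `m` independent standard Gaussian vectors in `ℝ^N`. -/
noncomputable def stdGaussianFam (N m : ℕ) :
    MeasureTheory.Measure (Fin m → Fin N → ℝ) :=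
  MeasureTheory.Measure.pi fun _ => stdGaussianVec N

/-- Given independent standard Gaussian vectors `X^{(1)},…,X^{(k-1)}` in `ℝ^N`
(indexed here by `Fin (k-1)`), with `Y^{(i)} = Uᵀ X^{(i)}`, the vectors
`Z^{(1)} = X^{(1)}`, `Z^{(i)} = Y^{(i-1)} ⊙ X^{(i)}` for `2 ≤ i ≤ k-1`, and
`Z^{(k)} = Y^{(k-1)}` (0-indexed below; out-of-range cases give junk `0`). -/
noncomputable def Zfam (N k : ℕ) (U : Fin N → Fin N → ℝ)
    (X : Fin (k - 1) → Fin N → ℝ) : Fin k → Fin N → ℝ := fun a j =>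
  if a.val = 0 then
    (if h : 0 < k - 1 then X ⟨0, h⟩ j else 0)
  else if a.val = k - 1 then
    (if h : k - 2 < k - 1 then ∑ l, U l j * X ⟨k - 2, h⟩ l else 0)
  else
    (if h : a.val - 1 < k - 1 ∧ a.val < k - 1 then
      (∑ l, U l j * X ⟨a.val - 1, h.1⟩ l) * X ⟨a.val, h.2⟩ j
    else 0)


open ProbabilityTheory

lemma sgn_measurable : Measurable sgn := by
  unfold sgn
  exact Measurable.ite measurableSet_Ici measurable_const measurable_const

lemma sgn_abs_le (t : ℝ) : ‖sgn t‖ ≤ 1 := by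
  unfold sgn; split_ifs <;> simp

lemma sgn_mul_of_ne {x y : ℝ} (hx : x ≠ 0) (hy : y ≠ 0) : sgn (x * y) = sgn x * sgn y := by
  unfold sgn
  rcases lt_or_gt_of_ne hx with h | h <;> rcases lt_or_gt_of_ne hy with h' | h'
  · simp [h.not_ge, h'.not_ge, (mul_pos_of_neg_of_neg h h').le]
  · simp [h.not_ge, h'.le, mul_neg_of_neg_of_pos h h']
  · simp [h.le, h'.not_ge, mul_neg_of_pos_of_neg h h']
  · simp [h.le, h'.le, (mul_pos h h').le]

lemma sgn_pos_mul {r t : ℝ} (hr : 0 < r) : sgn (r * t) = sgn t := by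
  unfold sgn
  simp [mul_nonneg_iff_of_pos_left hr]

/-- law of a linear combination of i.i.d. Gaussians -/
lemma map_linear (N : ℕ) (c : Fin N → ℝ) :
    (stdGaussianVec N).map (fun x => ∑ l, c l * x l) =
      gaussianReal 0 (Real.toNNReal (∑ l, c l ^ 2)) := by
  have hm : Measurable (fun x : Fin N → ℝ => ∑ l, c l * x l) := by fun_prop
  have : IsProbabilityMeasure (stdGaussianVec N) := by
    unfold stdGaussianVec; infer_instance
  have := Measure.isProbabilityMeasure_map (μ := stdGaussianVec N) hm.aemeasurable
  refine Measure.ext_of_charFun ?_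
  ext t
  rw [charFun_gaussianReal, charFun_apply_real, integral_map hm.aemeasurable (by fun_prop)]
  have h1 : ∀ x : Fin N → ℝ, Complex.exp (t * ((∑ l, c l * x l : ℝ) : ℂ) * Complex.I)
      = ∏ l, Complex.exp (((t * c l : ℝ) : ℂ) * (x l : ℂ) * Complex.I) := by
    intro x
    rw [← Complex.exp_sum]
    congr 1
    push_cast
    rw [Finset.mul_sum, Finset.sum_mul]
    exact Finset.sum_congr rfl fun l _ => by ring
  simp_rw [h1]
  unfold stdGaussianVec
  rw [integral_fintype_prod_eq_prod (f := fun l (x : ℝ) =>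
    Complex.exp (((t * c l : ℝ) : ℂ) * (x : ℂ) * Complex.I))]
  have h2 : ∀ l, ∫ x : ℝ, Complex.exp (((t * c l : ℝ) : ℂ) * (x : ℂ) * Complex.I) ∂(gaussianReal 0 1)
      = Complex.exp (- ((t * c l : ℝ) : ℂ) ^ 2 / 2) := by
    intro l
    rw [← charFun_apply_real, charFun_gaussianReal]
    congr 1; push_cast; ring
  simp_rw [h2]
  rw [← Complex.exp_sum]
  congr 1
  have h3 : ((Real.toNNReal (∑ l, c l ^ 2) : NNReal) : ℝ) = ∑ l, c l ^ 2 :=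
    Real.coe_toNNReal _ (Finset.sum_nonneg fun l _ => sq_nonneg _)
  have h4 : (((Real.toNNReal (∑ l, c l ^ 2) : NNReal) : ℝ) : ℂ) = ∑ l, (c l : ℂ) ^ 2 := by
    rw [h3]; push_cast; rfl
  rw [h4]
  push_cast
  rw [Finset.sum_mul, Finset.sum_div, mul_zero, zero_mul, zero_sub, ← Finset.sum_neg_distrib]
  exact Finset.sum_congr rfl fun l _ => by ring

lemma radial : ∫ r in Set.Ioi (0 : ℝ), r * ((2 * Real.pi)⁻¹ * Real.exp (-r ^ 2 / 2))
    = (2 * Real.pi)⁻¹ := by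
  have h := integral_rpow_mul_exp_neg_mul_rpow (p := 2) (q := 1) (b := 1/2)
    (by norm_num) (by norm_num) (by norm_num)
  have h2 : ∫ r in Set.Ioi (0 : ℝ), r * ((2 * Real.pi)⁻¹ * Real.exp (-r ^ 2 / 2))
     = ∫ r in Set.Ioi (0 : ℝ), (2 * Real.pi)⁻¹ * (r ^ (1:ℝ) * Real.exp (-(1/2) * r ^ (2:ℝ))) := by
    refine setIntegral_congr_fun measurableSet_Ioi fun r _ => ?_
    simp only [Real.rpow_one, Real.rpow_two]
    rw [show -r ^ 2 / 2 = -(1/2) * r ^ 2 by ring]; ring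
  rw [h2, integral_const_mul, h]
  norm_num

lemma circle (α : ℝ) (h0 : 0 ≤ α) (h1 : α ≤ Real.pi) :
    ∫ θ in Set.Ioo (-Real.pi) Real.pi, sgn (Real.cos θ) * sgn (Real.cos (θ - α))
      = 2 * (Real.pi - 2 * α) := by
  have hp := Real.pi_pos
  set g : ℝ → ℝ := fun θ => sgn (Real.cos θ) * sgn (Real.cos (θ - α)) with hg
  have hgm : Measurable g := (sgn_measurable.comp (by fun_prop)).mul (sgn_measurable.comp (by fun_prop))
  have hgi : ∀ a b, IntervalIntegrable g volume a b := by
    intro a b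
    rw [intervalIntegrable_iff]
    refine Measure.integrableOn_of_bounded (M := 1) (by simp) hgm.aestronglyMeasurable ?_
    refine Filter.Eventually.of_forall fun θ => ?_
    rw [hg]; simp only [norm_mul]
    exact mul_le_one₀ (sgn_abs_le _) (norm_nonneg _) (sgn_abs_le _)
  rw [← integral_Ioc_eq_integral_Ioo, ← intervalIntegral.integral_of_le (by linarith)]
  have hper : Function.Periodic g (2 * Real.pi) := by
    intro θ
    simp only [hg]
    rw [Real.cos_add_two_pi, show θ + 2 * Real.pi - α = (θ - α) + 2 * Real.pi by ring,
      Real.cos_add_two_pi]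
  have e1 : ∫ θ in (-Real.pi)..Real.pi, g θ = ∫ θ in (-(Real.pi/2))..(-(Real.pi/2) + 2 * Real.pi), g θ := by
    rw [← hper.intervalIntegral_add_eq (-Real.pi)]
    congr 1; ring
  rw [e1]
  -- pieces
  have piece : ∀ a b s : ℝ, a ≤ b → (∀ θ ∈ Set.Ioo a b, g θ = s) → ∫ θ in a..b, g θ = s * (b - a) := by
    intro a b s hab h
    rw [intervalIntegral.integral_of_le hab, integral_Ioc_eq_integral_Ioo,
      setIntegral_congr_fun measurableSet_Ioo h]
    simp [hab, mul_comm]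
  have sp : ∀ t, 0 < Real.cos t → sgn (Real.cos t) = 1 := fun t h => by simp [sgn, h.le]
  have sn : ∀ t, Real.cos t < 0 → sgn (Real.cos t) = -1 := fun t h => by simp [sgn, h.not_ge]
  have cn : ∀ t, -(Real.pi + Real.pi/2) < t → t < -(Real.pi/2) → Real.cos t < 0 := fun t h h' => by
    rw [← Real.cos_neg]; exact Real.cos_neg_of_pi_div_two_lt_of_lt (by linarith) (by linarith)
  have cn' : ∀ t, Real.pi/2 < t → t < Real.pi + Real.pi/2 → Real.cos t < 0 := fun t h h' =>
    Real.cos_neg_of_pi_div_two_lt_of_lt (by linarith) (by linarith)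
  have cp' : ∀ t, Real.pi + Real.pi/2 < t → t < 2 * Real.pi + Real.pi/2 → 0 < Real.cos t := fun t h h' => by
    rw [← Real.cos_sub_two_pi]; exact Real.cos_pos_of_mem_Ioo ⟨by linarith, by linarith⟩
  have cp : ∀ t, -(Real.pi/2) < t → t < Real.pi/2 → 0 < Real.cos t := fun t h h' =>
    Real.cos_pos_of_mem_Ioo ⟨by linarith, by linarith⟩
  have p1 := piece (-(Real.pi/2)) (α - Real.pi/2) (-1) (by linarith) (by
    rintro θ ⟨ha, hb⟩
    simp only [hg]
    rw [sp _ (cp θ ha (by linarith)), sn _ (cn _ (by linarith) (by linarith))]; norm_num)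
  have p2 := piece (α - Real.pi/2) (Real.pi/2) 1 (by linarith) (by
    rintro θ ⟨ha, hb⟩
    simp only [hg]
    rw [sp _ (cp θ (by linarith) hb), sp _ (cp _ (by linarith) (by linarith))]; norm_num)
  have p3 := piece (Real.pi/2) (α + Real.pi/2) (-1) (by linarith) (by
    rintro θ ⟨ha, hb⟩
    simp only [hg]
    rw [sn _ (cn' θ ha (by linarith)), sp _ (cp _ (by linarith) (by linarith))]; norm_num)
  have p4 := piece (α + Real.pi/2) (-(Real.pi/2) + 2 * Real.pi) 1 (by linarith) (by
    rintro θ ⟨ha, hb⟩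
    simp only [hg]
    rw [sn _ (cn' θ (by linarith) (by linarith)), sn _ (cn' _ (by linarith) (by linarith))]; norm_num)
  rw [← intervalIntegral.integral_add_adjacent_intervals (hgi (-(Real.pi/2)) (α - Real.pi/2)) (hgi _ (-(Real.pi/2) + 2 * Real.pi)),
    ← intervalIntegral.integral_add_adjacent_intervals (hgi (α - Real.pi/2) (Real.pi/2)) (hgi _ (-(Real.pi/2) + 2 * Real.pi)),
    ← intervalIntegral.integral_add_adjacent_intervals (hgi (Real.pi/2) (α + Real.pi/2)) (hgi _ (-(Real.pi/2) + 2 * Real.pi)),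
    p1, p2, p3, p4]
  ring

lemma sheppard_prod (ρ : ℝ) (h0 : -1 ≤ ρ) (h1 : ρ ≤ 1) :
    ∫ p : ℝ × ℝ, sgn p.1 * sgn (ρ * p.1 + Real.sqrt (1 - ρ ^ 2) * p.2)
      ∂((gaussianReal 0 1).prod (gaussianReal 0 1)) = 2 / Real.pi * Real.arcsin ρ := by
  have hp := Real.pi_pos
  have hd : (gaussianReal 0 1).prod (gaussianReal 0 1) =
      (volume : Measure (ℝ × ℝ)).withDensity
        (fun p => gaussianPDF 0 1 p.1 * gaussianPDF 0 1 p.2) := by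
    rw [gaussianReal_of_var_ne_zero _ one_ne_zero,
      prod_withDensity (by fun_prop) (by fun_prop), Measure.volume_eq_prod]
  rw [hd, integral_withDensity_eq_integral_toReal_smul (by fun_prop) (by
    refine Filter.Eventually.of_forall fun p => ?_
    exact ENNReal.mul_lt_top ENNReal.ofReal_lt_top ENNReal.ofReal_lt_top)]
  rw [← integral_comp_polarCoord_symm]
  set α := Real.arccos ρ with hα
  have hc : Real.cos α = ρ := Real.cos_arccos h0 h1
  have hs : Real.sin α = Real.sqrt (1 - ρ ^ 2) := Real.sin_arccos ρ
  have key : ∀ p ∈ polarCoord.target, 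
      p.1 • (((gaussianPDF 0 1 (polarCoord.symm p).1 * gaussianPDF 0 1 (polarCoord.symm p).2).toReal) •
        (sgn (polarCoord.symm p).1 * sgn (ρ * (polarCoord.symm p).1 + Real.sqrt (1 - ρ ^ 2) * (polarCoord.symm p).2)))
      = (p.1 * ((2 * Real.pi)⁻¹ * Real.exp (-p.1 ^ 2 / 2))) * (sgn (Real.cos p.2) * sgn (Real.cos (p.2 - α))) := by
    rintro ⟨r, θ⟩ ⟨hr, _⟩
    have hr : 0 < r := hr
    simp only [polarCoord_symm_apply, smul_eq_mul]
    rw [← hs, ← hc, show Real.cos α * (r * Real.cos θ) + Real.sin α * (r * Real.sin θ) = r * Real.cos (θ - α) by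
      rw [Real.cos_sub]; ring, sgn_pos_mul hr, sgn_pos_mul hr, ENNReal.toReal_mul,
      toReal_gaussianPDF, toReal_gaussianPDF]
    have : gaussianPDFReal 0 1 (r * Real.cos θ) * gaussianPDFReal 0 1 (r * Real.sin θ)
       = (2 * Real.pi)⁻¹ * Real.exp (-r ^ 2 / 2) := by
      simp only [gaussianPDFReal, NNReal.coe_one, mul_one, sub_zero]
      rw [mul_mul_mul_comm, ← Real.exp_add, ← mul_inv, Real.mul_self_sqrt (by positivity)]
      congr 2
      have := Real.sin_sq_add_cos_sq θ
      linear_combination (-r^2/2) * this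
    rw [this]; ring
  have htm : MeasurableSet polarCoord.target := polarCoord.open_target.measurableSet
  rw [setIntegral_congr_fun htm key]
  rw [show polarCoord.target = Set.Ioi (0:ℝ) ×ˢ Set.Ioo (-Real.pi) Real.pi from rfl, Measure.volume_eq_prod,
    setIntegral_prod_mul (fun r : ℝ => r * ((2 * Real.pi)⁻¹ * Real.exp (-r ^ 2 / 2)))
      (fun θ => sgn (Real.cos θ) * sgn (Real.cos (θ - α))), radial,
    circle α (Real.arccos_nonneg _) (Real.arccos_le_pi _), hα, Real.arccos_eq_pi_div_two_sub_arcsin]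
  field_simp
  ring

lemma sheppard_vec (N : ℕ) (c : Fin N → ℝ) (hc : ∑ l, c l ^ 2 = 1) (i : Fin N) :
    ∫ x, sgn (x i) * sgn (∑ l, c l * x l) ∂(stdGaussianVec N) = 2 / Real.pi * Real.arcsin (c i) := by
  obtain ⟨n, rfl⟩ : ∃ n, N = n + 1 := ⟨N - 1, by have := i.2; omega⟩
  rw [Fin.sum_univ_succAbove _ i] at hc
  have hsum : ∑ l, c (i.succAbove l) ^ 2 = 1 - c i ^ 2 := by linarith
  have hnn : 0 ≤ 1 - c i ^ 2 := by rw [← hsum]; exact Finset.sum_nonneg fun l _ => sq_nonneg _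
  have hab := abs_le.mp ((sq_le_one_iff_abs_le_one (c i)).mp (by linarith))
  rw [← sheppard_prod (c i) hab.1 hab.2]
  have hmp := (measurePreserving_piFinSuccAbove (fun _ : Fin (n+1) => gaussianReal 0 1) i)
  have hF : Measurable (fun p : ℝ × ℝ => sgn p.1 * sgn (c i * p.1 + p.2)) :=
    (sgn_measurable.comp (by fun_prop)).mul (sgn_measurable.comp (by fun_prop))
  have : IsProbabilityMeasure (stdGaussianVec n) := by
    unfold stdGaussianVec; infer_instance
  have hm : Measurable (fun x : Fin n → ℝ => ∑ l, c (i.succAbove l) * x l) := by fun_prop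
  have hlaw : (stdGaussianVec n).map (fun x => ∑ l, c (i.succAbove l) * x l)
      = (gaussianReal 0 1).map (fun w => Real.sqrt (1 - c i ^ 2) * w) := by
    rw [map_linear n (fun l => c (i.succAbove l)), gaussianReal_map_const_mul, hsum]
    congr 1
    · simp
    · ext; simp [Real.sq_sqrt hnn, hnn]
  have e1 : ∫ x, sgn (x i) * sgn (∑ l, c l * x l) ∂(stdGaussianVec (n+1))
     = ∫ q : ℝ × (Fin n → ℝ), sgn q.1 * sgn (c i * q.1 + ∑ l, c (i.succAbove l) * q.2 l)
        ∂((gaussianReal 0 1).prod (stdGaussianVec n)) := by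
    unfold stdGaussianVec
    rw [← hmp.integral_comp']
    refine integral_congr_ae (Filter.Eventually.of_forall fun x => ?_)
    simp only [Fin.sum_univ_succAbove _ i]
    rfl
  have e2 : ∫ q : ℝ × (Fin n → ℝ), sgn q.1 * sgn (c i * q.1 + ∑ l, c (i.succAbove l) * q.2 l)
        ∂((gaussianReal 0 1).prod (stdGaussianVec n))
      = ∫ p : ℝ × ℝ, sgn p.1 * sgn (c i * p.1 + p.2)
         ∂((gaussianReal 0 1).prod ((stdGaussianVec n).map (fun x => ∑ l, c (i.succAbove l) * x l))) := by
    have := Measure.map_prod_map (gaussianReal 0 1) (stdGaussianVec n) measurable_id hm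
    rw [Measure.map_id] at this
    rw [this, integral_map (by fun_prop) hF.aestronglyMeasurable]
    rfl
  have e3 : ∫ p : ℝ × ℝ, sgn p.1 * sgn (c i * p.1 + Real.sqrt (1 - c i ^ 2) * p.2)
      ∂((gaussianReal 0 1).prod (gaussianReal 0 1))
      = ∫ p : ℝ × ℝ, sgn p.1 * sgn (c i * p.1 + p.2)
         ∂((gaussianReal 0 1).prod ((gaussianReal 0 1).map (fun w => Real.sqrt (1 - c i ^ 2) * w))) := by
    have := Measure.map_prod_map (gaussianReal 0 1) (gaussianReal 0 1) measurable_id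
      (g := fun w => Real.sqrt (1 - c i ^ 2) * w) (by fun_prop)
    rw [Measure.map_id] at this
    rw [this, integral_map (by fun_prop) hF.aestronglyMeasurable]
    rfl
  rw [e1, e2, e3, hlaw]

lemma mul_arcsin_ge (t : ℝ) (h : |t| ≤ 1) : t ^ 2 ≤ t * Real.arcsin t := by
  obtain ⟨ha, hb⟩ := abs_le.mp h
  rcases le_total 0 t with h0 | h0
  · have : t ≤ Real.arcsin t := by
      have := Real.sin_le (Real.arcsin_nonneg.mpr h0)
      rwa [Real.sin_arcsin ha hb] at this
    nlinarith
  · have : Real.arcsin t ≤ t := by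
      have := Real.sin_le (x := -Real.arcsin t) (by simpa using h0)
      rw [Real.sin_neg, Real.sin_arcsin ha hb] at this; linarith
    nlinarith

lemma path_sum (N : ℕ) (B : Fin N → Fin N → ℝ) (hB : ∀ i, ∑ j, B i j = 1) (m : ℕ) :
    ∑ i : Fin (m + 1) → Fin N, ∏ b : Fin m, B (i b.castSucc) (i b.succ) = N := by
  induction m with
  | zero => simp
  | succ m ih =>
    rw [← (Fin.snocEquiv (fun _ : Fin (m+2) => Fin N)).sum_comp, Fintype.sum_prod_type,
      Finset.sum_comm]
    rw [← ih]
    refine Finset.sum_congr rfl fun f _ => ?_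
    simp only [Fin.prod_univ_castSucc, Fin.snocEquiv_apply, Fin.snoc_castSucc, Fin.succ_castSucc,
      Fin.succ_last, Fin.snoc_last]
    rw [← Finset.mul_sum, hB, mul_one]

lemma lin_ne (N : ℕ) (c : Fin N → ℝ) (hc : ∑ l, c l ^ 2 = 1) :
    ∀ᵐ x ∂(stdGaussianVec N), ∑ l, c l * x l ≠ 0 := by
  have hm : Measurable (fun x : Fin N → ℝ => ∑ l, c l * x l) := by fun_prop
  have h := map_linear N c
  rw [hc] at h
  have := nullSingletonClass_gaussianReal (μ := 0) (v := 1) one_ne_zero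
  have h2 : ∀ᵐ y ∂(gaussianReal 0 1), y ≠ 0 := by
    rw [ae_iff]; simp
  have h3 : ∀ᵐ y ∂((stdGaussianVec N).map (fun x => ∑ l, c l * x l)), y ≠ 0 := by
    rw [h]; simpa using h2
  exact ae_of_ae_map hm.aemeasurable h3

lemma coord_ne (N : ℕ) (j : Fin N) : ∀ᵐ x ∂(stdGaussianVec N), x j ≠ 0 := by
  have := lin_ne N (fun l => if l = j then 1 else 0) (by simp)
  simpa using this

lemma prod_split (N m : ℕ) (U : Fin N → Fin N → ℝ) (X : Fin (m + 1) → Fin N → ℝ)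
    (i : Fin (m + 2) → Fin N)
    (hX : ∀ b j, X b j ≠ 0) (hY : ∀ b j, ∑ l, U l j * X b l ≠ 0) :
    ∏ a : Fin (m + 2), sgn (Zfam N (m + 2) U X a (i a)) =
      ∏ b : Fin (m + 1), (sgn (X b (i b.castSucc)) * sgn (∑ l, U l (i b.succ) * X b l)) := by
  set P : Fin (m + 2) → ℝ := fun a => if h : a.val < m + 1 then sgn (X ⟨a, h⟩ (i a)) else 1 with hP
  set Q : Fin (m + 2) → ℝ := fun a => if h : 0 < a.val then
    sgn (∑ l, U l (i a) * X ⟨a - 1, by have := a.2; omega⟩ l) else 1 with hQ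
  have h1 : ∀ a, sgn (Zfam N (m + 2) U X a (i a)) = P a * Q a := by
    intro a
    have ha := a.2
    simp only [Zfam, hP, hQ]
    by_cases h0 : a.val = 0
    · simp [h0]
    · by_cases hl : a.val = m + 1
      · simp [hl]
      · have hlt : a.val < m + 1 := by omega
        have hpos : 0 < a.val := by omega
        have hlt' : a.val - 1 < m + 1 := by omega
        have hl' : ¬ (a.val = m + 2 - 1) := by omega
        rw [if_neg h0, if_neg hl', dif_pos ⟨by omega, by omega⟩, dif_pos hlt, dif_pos hpos,
          sgn_mul_of_ne (hY _ _) (hX _ _), mul_comm]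
  rw [Finset.prod_congr rfl fun a _ => h1 a, Finset.prod_mul_distrib, Finset.prod_mul_distrib,
    Fin.prod_univ_castSucc P, Fin.prod_univ_succ Q]
  have hle : ∀ x : Fin (m + 1), x.val ≤ m := fun x => by have := x.2; omega
  simp [hP, hQ, hle]

theorem rorrelation_of_hard_distribution (N k : ℕ) (hN : 1 ≤ N) (hk : 2 ≤ k)
    (U : Fin N → Fin N → ℝ) (hU : IsOrthogonal U) :
    (2 / Real.pi) ^ (k - 1) ≤
      ∫ X, phiU N k U (fun a j => sgn (Zfam N k U X a j))
        ∂(stdGaussianFam N (k - 1)) := by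
  obtain ⟨m, rfl⟩ : ∃ m, k = m + 2 := ⟨k - 2, by omega⟩
  have hp := Real.pi_pos
  have : IsProbabilityMeasure (stdGaussianVec N) := by
    unfold stdGaussianVec; infer_instance
  have hcol : ∀ j, ∑ l, U l j ^ 2 = 1 := fun j => by
    have := hU.1 j j; simpa [sq] using this
  have hrow : ∀ i, ∑ j, U i j ^ 2 = 1 := fun i => by
    have := hU.2 i i; simpa [sq] using this
  have hUle : ∀ i j, |U i j| ≤ 1 := fun i j => by
    rw [← sq_le_one_iff_abs_le_one, ← hrow i]
    exact Finset.single_le_sum (f := fun j => U i j ^ 2) (fun j _ => sq_nonneg _) (Finset.mem_univ j)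
  let F : Fin N → Fin N → (Fin N → ℝ) → ℝ := fun i j x =>
    sgn (x i) * sgn (∑ l, U l j * x l) * U i j
  have hFint : ∀ i j, Integrable (F i j) (stdGaussianVec N) := by
    intro i j
    refine Integrable.mul_const ?_ _
    refine Integrable.of_bound (C := 1) (Measurable.aestronglyMeasurable ?_) ?_
    · exact (sgn_measurable.comp (by fun_prop)).mul (sgn_measurable.comp (by fun_prop))
    · refine Filter.Eventually.of_forall fun x => ?_
      rw [norm_mul]
      exact mul_le_one₀ (sgn_abs_le _) (norm_nonneg _) (sgn_abs_le _)
  have hFge : ∀ i j, 2 / Real.pi * U i j ^ 2 ≤ ∫ x, F i j x ∂(stdGaussianVec N) := by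
    intro i j
    simp only [F]
    rw [integral_mul_const, sheppard_vec N (fun l => U l j) (hcol j) i]
    have := mul_le_mul_of_nonneg_left (mul_arcsin_ge _ (hUle i j)) (by positivity : 0 ≤ 2 / Real.pi)
    linarith
  have hae : ∀ᵐ X ∂(stdGaussianFam N (m + 1)),
      (∀ b j, X b j ≠ 0) ∧ (∀ b j, ∑ l, U l j * X b l ≠ 0) := by
    have hq : ∀ b : Fin (m+1), Filter.Tendsto (Function.eval b) (ae (stdGaussianFam N (m+1)))
        (ae (stdGaussianVec N)) := fun b =>
      (Measure.quasiMeasurePreserving_eval (fun _ : Fin (m+1) => stdGaussianVec N) b).tendsto_ae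
    refine Filter.Eventually.and ?_ ?_
    · exact ae_all_iff.2 fun b => ae_all_iff.2 fun j => (hq b).eventually (coord_ne N j)
    · exact ae_all_iff.2 fun b => ae_all_iff.2 fun j => (hq b).eventually (lin_ne N _ (hcol j))
  have hphi : ∫ X, phiU N (m+2) U (fun a j => sgn (Zfam N (m+2) U X a j)) ∂(stdGaussianFam N (m + 1))
      = ∫ X, (1 / N : ℝ) * ∑ i : Fin (m + 2) → Fin N, ∏ b : Fin (m+1), F (i b.castSucc) (i b.succ) (X b)
         ∂(stdGaussianFam N (m + 1)) := by
    refine integral_congr_ae ?_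
    filter_upwards [hae] with X hX
    unfold phiU
    congr 1
    refine Finset.sum_congr rfl fun i _ => ?_
    rw [prod_split N m U X i hX.1 hX.2]
    simp only [F]
    rw [Finset.prod_mul_distrib (g := fun b : Fin (m+1) => U (i b.castSucc) (i b.succ))]
    rfl
  change (2 / Real.pi) ^ (m + 1) ≤ ∫ X, phiU N (m+2) U (fun a j => sgn (Zfam N (m+2) U X a j)) ∂(stdGaussianFam N (m + 1))
  rw [hphi, integral_const_mul]
  unfold stdGaussianFam
  rw [integral_finsetSum _ (fun i _ => Integrable.fintype_prod_dep
    (f := fun (b : Fin (m+1)) x => F (i b.castSucc) (i b.succ) x) (fun b => hFint _ _))]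
  have hNpos : (0:ℝ) < N := by exact_mod_cast hN
  have hps := path_sum N (fun i j => U i j ^ 2) hrow (m + 1)
  calc (2 / Real.pi) ^ (m + 1)
      = 1 / N * ((2 / Real.pi) ^ (m + 1) * ∑ i : Fin (m + 1 + 1) → Fin N, ∏ b : Fin (m + 1), U (i b.castSucc) (i b.succ) ^ 2) := by
        rw [hps]; field_simp
    _ ≤ _ := by
        refine mul_le_mul_of_nonneg_left ?_ (by positivity)
        rw [Finset.mul_sum]
        refine Finset.sum_le_sum fun i _ => ?_
        rw [integral_fintype_prod_eq_prod
          (f := fun (b : Fin (m+1)) x => F (i b.castSucc) (i b.succ) x)]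
        calc _ = ∏ b : Fin (m + 1), (2 / Real.pi * U (i b.castSucc) (i b.succ) ^ 2) := by
              rw [Finset.prod_mul_distrib, Finset.prod_const, Finset.card_univ, Fintype.card_fin]
          _ ≤ _ := Finset.prod_le_prod (fun b _ => by positivity) fun b _ => hFge _ _
end

section
/- Let U ∈ ℝ^{N×N} be an orthogonal matrix and let S, T ⊆ [N]. Define Ũ(S,T) = E_X[ sgn( ∏_{i∈S} X_i · ∏_{j∈T} (UᵀX)_j ) ], where X is a standard Gaussian vector in ℝ^N. Then: (1) if |S|+|T| is odd, Ũ(S,T) = 0; and (2) if |S|+|T| is even, |Ũ(S,T)| ≤ (50·‖U_{S,T}‖)^{max(|S|,|T|)}, where U_{S,T} is the submatrix of U with rows indexed by S and columns indexed by T and ‖·‖ is the operator (spectral) norm on matrices. -/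
open scoped BigOperators
open MeasureTheory

/-- The operator (spectral) norm of a real matrix `A` (given as a function):
`‖A‖ = sup_{x ≠ 0} ‖Ax‖₂ / ‖x‖₂` (and `0` if the index types are empty). -/
noncomputable def opNorm {m n : Type} [Fintype m] [Fintype n]
    (A : m → n → ℝ) : ℝ :=
  sSup {r : ℝ | ∃ x : n → ℝ, x ≠ 0 ∧
    r = Real.sqrt (∑ i, (∑ j, A i j * x j) ^ 2) / Real.sqrt (∑ j, x j ^ 2)}

/-- The operator norm of the submatrix `U_{S,T}` of `U` with rows indexed by
`S` and columns indexed by `T`. -/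
noncomputable def subOpNorm {N : ℕ} (U : Fin N → Fin N → ℝ)
    (S T : Finset (Fin N)) : ℝ :=
  opNorm (fun (i : {a // a ∈ S}) (j : {a // a ∈ T}) => U i.val j.val)

/-- `Ũ(S,T) = E_X[ sgn( ∏_{i∈S} X_i · ∏_{j∈T} (UᵀX)_j ) ]` for a standard
Gaussian vector `X` in `ℝ^N`. -/
noncomputable def Utilde (N : ℕ) (U : Fin N → Fin N → ℝ)
    (S T : Finset (Fin N)) : ℝ :=
  ∫ X, sgn ((∏ i ∈ S, X i) * ∏ j ∈ T, ∑ l, U l j * X l) ∂(stdGaussianVec N)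

noncomputable def gaussPi (ι : Type) [Fintype ι] : Measure (ι → ℝ) :=
  Measure.pi fun _ => ProbabilityTheory.gaussianReal 0 1

instance gaussPi_prob (ι : Type) [Fintype ι] : IsProbabilityMeasure (gaussPi ι) := by
  unfold gaussPi; infer_instance

lemma gaussPi_char {ι : Type} [Fintype ι] (a : ι → ℝ) :
    ∫ x, Complex.exp ((∑ k, a k * x k : ℝ) * Complex.I) ∂(gaussPi ι)
      = Complex.exp (-((∑ k, a k ^ 2 : ℝ) : ℂ) / 2) := by
  have h1 : ∀ x : ι → ℝ, Complex.exp ((∑ k, a k * x k : ℝ) * Complex.I)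
      = ∏ k, Complex.exp ((a k : ℂ) * (x k : ℂ) * Complex.I) := by
    intro x
    rw [← Complex.exp_sum]
    push_cast
    rw [Finset.sum_mul]
  simp_rw [h1]
  unfold gaussPi
  rw [integral_fintype_prod_eq_prod (𝕜 := ℂ)
    (fun k (y : ℝ) => Complex.exp ((a k : ℂ) * (y : ℂ) * Complex.I))]
  have h2 : ∀ k, ∫ y : ℝ, Complex.exp ((a k : ℂ) * (y : ℂ) * Complex.I)
      ∂(ProbabilityTheory.gaussianReal 0 1) = Complex.exp (-((a k : ℂ) ^ 2) / 2) := by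
    intro k
    rw [← charFun_apply_real, ProbabilityTheory.charFun_gaussianReal]
    congr 1
    simp
    ring
  simp_rw [h2]
  rw [← Complex.exp_sum]
  congr 1
  push_cast
  rw [← Finset.sum_div, Finset.sum_neg_distrib]

lemma measurable_mulVec {ι m : Type} [Fintype ι] [Fintype m] (A : Matrix m ι ℝ) :
    Measurable (fun x : ι → ℝ => A.mulVec x) := by
  have : Continuous (fun x : ι → ℝ => A.mulVec x) := by fun_prop
  exact this.measurable

lemma gauss_law {ι κ m : Type} [Fintype ι] [Fintype κ] [Fintype m]
    (A : Matrix m ι ℝ) (B : Matrix m κ ℝ) (h : A * A.transpose = B * B.transpose) :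
    (gaussPi ι).map (fun x => A.mulVec x) = (gaussPi κ).map (fun x => B.mulVec x) := by
  classical
  have key : ∀ {ι : Type} [Fintype ι] (A : Matrix m ι ℝ) (L : StrongDual ℝ (m → ℝ)),
      charFunDual ((gaussPi ι).map (fun x => A.mulVec x)) L
      = Complex.exp (-(((fun i => L (Pi.single i 1)) ⬝ᵥ
          (A * A.transpose).mulVec (fun i => L (Pi.single i 1)) : ℝ) : ℂ) / 2) := by
    intro ι _ A L
    set t : m → ℝ := fun i => L (Pi.single i 1) with ht
    rw [charFunDual_apply, integral_map (measurable_mulVec A).aemeasurable (by fun_prop)]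
    have hL : ∀ y, L y = t ⬝ᵥ y := by
      intro y
      conv_lhs => rw [← Finset.univ_sum_single y]
      rw [map_sum, dotProduct]
      refine Finset.sum_congr rfl fun i _ => ?_
      have : (Pi.single i (y i) : m → ℝ) = y i • Pi.single i 1 := by
        rw [← Pi.single_smul]; simp
      rw [this, map_smul]
      simp [ht, mul_comm]
    have h2 : ∀ x, L (A.mulVec x) = ∑ k, (A.transpose.mulVec t) k * x k := by
      intro x
      rw [hL, Matrix.dotProduct_mulVec, ← Matrix.mulVec_transpose]
      rfl
    simp_rw [h2]
    rw [gaussPi_char]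
    have : ∑ k, (A.transpose.mulVec t) k ^ 2 = t ⬝ᵥ (A * A.transpose).mulVec t := by
      rw [← Matrix.mulVec_mulVec, Matrix.dotProduct_mulVec, ← Matrix.mulVec_transpose, dotProduct]
      simp_rw [sq]
    rw [this]
  have : IsProbabilityMeasure ((gaussPi ι).map (fun x => A.mulVec x)) :=
    Measure.isProbabilityMeasure_map (measurable_mulVec A).aemeasurable
  have : IsProbabilityMeasure ((gaussPi κ).map (fun x => B.mulVec x)) :=
    Measure.isProbabilityMeasure_map (measurable_mulVec B).aemeasurable
  apply Measure.ext_of_charFunDual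
  funext L
  rw [key, key, h]

lemma sign_mul' (a b : ℝ) : Real.sign (a * b) = Real.sign a * Real.sign b := by
  rcases lt_trichotomy a 0 with ha | ha | ha <;> rcases lt_trichotomy b 0 with hb | hb | hb <;>
    simp [ha, hb, Real.sign_of_neg, Real.sign_of_pos, mul_pos_of_neg_of_neg,
      mul_neg_of_neg_of_pos, mul_neg_of_pos_of_neg]

lemma sign_prod' {ι : Type} (s : Finset ι) (f : ι → ℝ) :
    Real.sign (∏ i ∈ s, f i) = ∏ i ∈ s, Real.sign (f i) := by
  classical
  induction s using Finset.induction_on with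
  | empty => simp
  | insert a s ha ih => rw [Finset.prod_insert ha, Finset.prod_insert ha, sign_mul', ih]

lemma abs_sign_le (a : ℝ) : |Real.sign a| ≤ 1 := by
  rcases Real.sign_apply_eq a with h | h | h <;> simp [h]

lemma measurable_sign' : Measurable Real.sign := by
  unfold Real.sign
  exact Measurable.ite measurableSet_Iio measurable_const
    (Measurable.ite measurableSet_Ioi measurable_const measurable_const)

lemma sgn_eq_sign {t : ℝ} (h : t ≠ 0) : sgn t = Real.sign t := by
  unfold sgn
  rcases lt_or_gt_of_ne h with h | h
  · rw [if_neg (not_le.2 h), Real.sign_of_neg h]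
  · rw [if_pos h.le, Real.sign_of_pos h]

lemma gauss_Icc (c : ℝ) (hc : 0 ≤ c) :
    (ProbabilityTheory.gaussianReal 0 1).real (Set.Icc (-c) c) ≤ 2 * c := by
  rw [Measure.real, ProbabilityTheory.gaussianReal_apply _ one_ne_zero]
  apply ENNReal.toReal_le_of_le_ofReal (by positivity)
  have hb : ∀ x, ProbabilityTheory.gaussianPDF 0 1 x ≤ 1 := by
    intro x
    rw [ProbabilityTheory.gaussianPDF, ProbabilityTheory.gaussianPDFReal]
    apply ENNReal.ofReal_le_one.2
    apply mul_le_one₀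
    · apply inv_le_one_of_one_le₀
      rw [Real.one_le_sqrt]
      have := Real.pi_gt_three
      simp; linarith
    · positivity
    · apply Real.exp_le_one_iff.2
      have : 0 ≤ (x - 0) ^ 2 / (2 * ((1 : NNReal) : ℝ)) := by positivity
      rw [neg_div]; linarith
  calc _ ≤ ∫⁻ x in Set.Icc (-c) c, 1 := lintegral_mono fun x => hb x
    _ = _ := by
      rw [setLIntegral_one, Real.volume_Icc]
      congr 1; ring

lemma inner_bound (a s : ℝ) (hs : 0 < s) :
    |∫ w, Real.sign (a + s * w) ∂(ProbabilityTheory.gaussianReal 0 1)| ≤ 2 * (|a| / s) := by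
  set γ := ProbabilityTheory.gaussianReal 0 1 with hγ
  have hm : ∀ s : ℝ, Integrable (fun w => Real.sign (a + s * w)) γ := by
    intro s
    apply Integrable.of_bound (C := 1)
    · exact (measurable_sign'.comp (by fun_prop)).aestronglyMeasurable
    · exact Filter.Eventually.of_forall fun x => abs_sign_le _
  have hsym : ∫ w, Real.sign (a + s * w) ∂γ = ∫ w, Real.sign (a + (-s) * w) ∂γ := by
    have : γ.map (fun x => -x) = γ := by
      rw [hγ, ProbabilityTheory.gaussianReal_map_neg, neg_zero]
    conv_lhs => rw [← this]
    have hms : Measurable (fun w => Real.sign (a + s * w)) :=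
      measurable_sign'.comp (by fun_prop)
    rw [integral_map measurable_neg.aemeasurable hms.aestronglyMeasurable]
    simp
  have h2 : ∫ w, Real.sign (a + s * w) ∂γ
      = ∫ w, (Real.sign (a + s * w) + Real.sign (a + (-s) * w)) / 2 ∂γ := by
    rw [integral_div, integral_add (hm _) (hm _), ← hsym]; ring
  rw [h2]
  calc _ ≤ ∫ w, |(Real.sign (a + s * w) + Real.sign (a + (-s) * w)) / 2| ∂γ :=
        abs_integral_le_integral_abs
    _ ≤ ∫ w, (Set.Icc (-(|a| / s)) (|a| / s)).indicator 1 w ∂γ := by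
        apply integral_mono (((hm _).add (hm _)).div_const 2).abs
        · exact (integrable_const (1 : ℝ)).indicator measurableSet_Icc
        intro w
        change |(Real.sign (a + s * w) + Real.sign (a + (-s) * w)) / 2| ≤ _
        by_cases hw : w ∈ Set.Icc (-(|a| / s)) (|a| / s)
        · rw [Set.indicator_of_mem hw]
          have h1 := abs_sign_le (a + s * w)
          have h2 := abs_sign_le (a + (-s) * w)
          simp only [Pi.one_apply]
          rw [abs_le] at *
          constructor <;> linarith [h1.1, h1.2, h2.1, h2.2]
        · rw [Set.indicator_of_notMem hw]
          have : |a| < |s * w| := by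
            rw [Set.mem_Icc, ← abs_le, not_le, div_lt_iff₀ hs] at hw
            rwa [abs_mul, abs_of_pos hs, mul_comm]
          have : Real.sign (a + s * w) + Real.sign (a + (-s) * w) = 0 := by
            rcases lt_or_ge 0 (s * w) with h | h
            · rw [abs_of_pos h, abs_lt] at this
              rw [Real.sign_of_pos (by linarith), Real.sign_of_neg (by linarith)]; ring
            · rw [abs_of_nonpos h, abs_lt] at this
              rw [Real.sign_of_neg (by linarith), Real.sign_of_pos (by linarith)]; ring
          rw [this]; simp
    _ = γ.real (Set.Icc (-(|a| / s)) (|a| / s)) := by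
        rw [integral_indicator_one measurableSet_Icc]
    _ ≤ _ := gauss_Icc _ (by positivity)

lemma gauss_abs_integrable : Integrable (fun x : ℝ => |x|) (ProbabilityTheory.gaussianReal 0 1) := by
  have := ProbabilityTheory.memLp_id_gaussianReal (μ := 0) (v := 1) 1
  have h : Integrable (id : ℝ → ℝ) (ProbabilityTheory.gaussianReal 0 1) :=
    memLp_one_iff_integrable.1 (by simpa using this)
  exact h.abs

lemma gauss_abs : ∫ x, |x| ∂(ProbabilityTheory.gaussianReal 0 1) ≤ 1 := by
  have h2 := (ProbabilityTheory.memLp_id_gaussianReal (μ := 0) (v := 1) 2)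
  have hsq : Integrable (fun x : ℝ => x ^ 2) (ProbabilityTheory.gaussianReal 0 1) := by
    have h3 : MemLp (id : ℝ → ℝ) 2 (ProbabilityTheory.gaussianReal 0 1) := by simpa using h2
    exact h3.integrable_sq
  have hv : ∫ x, x ^ 2 ∂(ProbabilityTheory.gaussianReal 0 1) = 1 := by
    have := ProbabilityTheory.variance_id_gaussianReal (μ := 0) (v := 1)
    rw [ProbabilityTheory.variance_of_integral_eq_zero (by fun_prop) (by simp)] at this
    simpa using this
  calc _ ≤ ∫ x, (1 + x ^ 2) / 2 ∂(ProbabilityTheory.gaussianReal 0 1) := by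
        apply integral_mono gauss_abs_integrable (((integrable_const _).add hsq).div_const 2)
        intro x
        have := sq_nonneg (|x| - 1)
        simp only [Pi.add_apply]
        rw [← sq_abs x]; linarith
    _ = 1 := by
        rw [integral_div, integral_add (integrable_const _) hsq, hv]; simp

open scoped MatrixOrder in
lemma exists_sqrt_mat {m : Type} [Fintype m] [DecidableEq m] (P : Matrix m m ℝ)
    (hP : P.PosSemidef) : ∃ R : Matrix m m ℝ, R * R.transpose = P := by
  refine ⟨CFC.sqrt P, ?_⟩
  have h := (Matrix.nonneg_iff_posSemidef.1 (CFC.sqrt_nonneg P)).isHermitian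
  have h2 : (CFC.sqrt P).transpose = CFC.sqrt P := by
    simpa [Matrix.IsHermitian, Matrix.conjTranspose_eq_transpose_of_trivial] using h
  rw [h2]
  exact CFC.sqrt_mul_sqrt_self P hP.nonneg

lemma prod_abs_le_one {ι : Type} (s : Finset ι) (f : ι → ℝ) :
    |∏ i ∈ s, Real.sign (f i)| ≤ 1 := by
  rw [← sign_prod']; exact abs_sign_le _

lemma gauss_main {ι m n : Type} [Fintype ι] [Fintype m] [Fintype n] [DecidableEq m] [DecidableEq n]
    (A : Matrix m ι ℝ) (B : Matrix n ι ℝ) (hA : A * A.transpose = 1) (hB : B * B.transpose = 1)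
    (ε : ℝ) (hε : 0 ≤ ε) (hε' : ε ≤ 1 / 50)
    (h : ∀ x : m → ℝ, ∑ j, ((A * B.transpose).transpose.mulVec x j) ^ 2 ≤ ε ^ 2 * ∑ i, x i ^ 2) :
    |∫ x, (∏ i, Real.sign (A.mulVec x i)) * ∏ j, Real.sign (B.mulVec x j) ∂(gaussPi ι)|
      ≤ (50 * ε) ^ Fintype.card m := by
  set M := A * B.transpose with hM
  obtain ⟨R, hR⟩ := exists_sqrt_mat (ε ^ 2 • (1 : Matrix m m ℝ) - M * M.transpose) (by
    rw [Matrix.posSemidef_iff_dotProduct_mulVec]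
    constructor
    · rw [Matrix.IsHermitian, Matrix.conjTranspose_eq_transpose_of_trivial]
      simp
    · intro x
      have := h x
      rw [Matrix.sub_mulVec, dotProduct_sub, ← Matrix.mulVec_mulVec, Matrix.dotProduct_mulVec _ M,
        Matrix.smul_mulVec, Matrix.one_mulVec, dotProduct_smul]
      simp only [star_trivial]
      rw [← Matrix.mulVec_transpose, dotProduct, dotProduct, smul_eq_mul]
      simp_rw [← sq]
      linarith)
  set s := Real.sqrt (1 - ε ^ 2) with hs
  have hs2 : s ^ 2 = 1 - ε ^ 2 := Real.sq_sqrt (by nlinarith)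
  have hs1 : 1 / 25 ≤ s := Real.le_sqrt_of_sq_le (by nlinarith)
  have hs0 : 0 < s := by linarith
  let K : Matrix m (n ⊕ m) ℝ := Matrix.fromCols M R
  have hK : K * K.transpose = (ε • (1 : Matrix m m ℝ)) * (ε • (1 : Matrix m m ℝ)).transpose := by
    simp only [K, Matrix.transpose_fromCols, Matrix.fromCols_mul_fromRows, hR]
    simp [smul_smul, sq]
  let J : Matrix n (n ⊕ m) ℝ := Matrix.fromCols 1 0
  let C : Matrix (m ⊕ n) ι ℝ := Matrix.fromRows A B
  let D : Matrix (m ⊕ n) ((n ⊕ m) ⊕ m) ℝ := Matrix.fromBlocks K (s • 1) J 0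
  have hCD : C * C.transpose = D * D.transpose := by
    simp only [C, D, Matrix.transpose_fromRows, Matrix.fromRows_mul_fromCols,
      Matrix.fromBlocks_transpose, Matrix.fromBlocks_multiply]
    congr 1
    · rw [hA, hK]
      simp only [Matrix.transpose_smul, Matrix.transpose_one, smul_mul_assoc, one_mul, smul_smul,
        ← add_smul]
      rw [← sq, ← sq, hs2]; simp
    · simp only [K, J, Matrix.transpose_fromCols, Matrix.fromCols_mul_fromRows]
      simp [hM]
    · simp only [K, J, Matrix.transpose_fromCols, Matrix.fromCols_mul_fromRows]
      simp [hM]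
    · simp only [J, Matrix.transpose_fromCols, Matrix.fromCols_mul_fromRows]
      simp [hB]
  let F : (m ⊕ n → ℝ) → ℝ := fun y =>
    (∏ i, Real.sign (y (Sum.inl i))) * ∏ j, Real.sign (y (Sum.inr j))
  have hF : Measurable F := by
    refine Measurable.mul (Finset.measurable_prod _ fun i _ => ?_)
      (Finset.measurable_prod _ fun i _ => ?_)
    · exact measurable_sign'.comp (measurable_pi_apply _)
    · exact measurable_sign'.comp (measurable_pi_apply _)
  have hF1 : ∀ y, |F y| ≤ 1 := by
    intro y
    rw [abs_mul]
    exact mul_le_one₀ (prod_abs_le_one _ _) (abs_nonneg _) (prod_abs_le_one _ _)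
  have e1 : ∫ x, (∏ i, Real.sign (A.mulVec x i)) * ∏ j, Real.sign (B.mulVec x j) ∂(gaussPi ι)
      = ∫ x, F (D.mulVec x) ∂(gaussPi ((n ⊕ m) ⊕ m)) := by
    have : ∫ x, F (C.mulVec x) ∂(gaussPi ι) = ∫ x, F (D.mulVec x) ∂(gaussPi ((n ⊕ m) ⊕ m)) := by
      rw [← integral_map (measurable_mulVec C).aemeasurable hF.aestronglyMeasurable,
        ← integral_map (measurable_mulVec D).aemeasurable hF.aestronglyMeasurable,
        gauss_law C D hCD]
    rw [← this]
    simp [F, C, Matrix.fromRows_mulVec]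
  have e2 : ∫ x, F (D.mulVec x) ∂(gaussPi ((n ⊕ m) ⊕ m))
      = ∫ p, F (Sum.elim (fun i => K.mulVec p.1 i + s * p.2 i) (fun j => p.1 (Sum.inl j)))
          ∂((gaussPi (n ⊕ m)).prod (gaussPi m)) := by
    have hmp := measurePreserving_sumPiEquivProdPi_symm (ι := n ⊕ m) (ι' := m)
      (X := fun _ => ℝ) (fun _ => ProbabilityTheory.gaussianReal 0 1)
    have := hmp.integral_comp' (fun x => F (D.mulVec x))
    unfold gaussPi
    rw [← this]
    refine integral_congr_ae (Filter.Eventually.of_forall fun p => ?_)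
    simp only
    congr 1
    simp only [D, Matrix.fromBlocks_mulVec]
    congr 1
    · funext i
      simp only [Matrix.smul_mulVec, Matrix.one_mulVec]
      rfl
    · funext i
      simp only [J, Matrix.fromCols_mulVec]
      simp
      rfl
  have hmeas : Measurable (fun p : (n ⊕ m → ℝ) × (m → ℝ) =>
      F (Sum.elim (fun i => K.mulVec p.1 i + s * p.2 i) (fun j => p.1 (Sum.inl j)))) := by
    apply hF.comp
    apply measurable_pi_lambda
    rintro (i | j)
    · simp only [Sum.elim_inl]
      have h1 : Measurable (fun p : (n ⊕ m → ℝ) × (m → ℝ) => K.mulVec p.1 i) :=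
        (measurable_pi_apply i).comp ((measurable_mulVec K).comp measurable_fst)
      exact h1.add (by fun_prop)
    · simp only [Sum.elim_inr]
      fun_prop
  rw [e1, e2, integral_prod _ (Integrable.of_bound hmeas.aestronglyMeasurable 1
    (Filter.Eventually.of_forall fun p => hF1 _))]
  let G : (m → ℝ) → ℝ := fun y => ∏ i, (2 / s * |y i|)
  have hG : Measurable G := Finset.measurable_prod _ fun i _ => by fun_prop
  have hin : ∀ u : n ⊕ m → ℝ, ‖∫ w, F (Sum.elim (fun i => K.mulVec u i + s * w i)
      (fun j => u (Sum.inl j))) ∂(gaussPi m)‖ ≤ G (K.mulVec u) := by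
    intro u
    simp only [F, Sum.elim_inl, Sum.elim_inr]
    rw [integral_mul_const, norm_mul]
    unfold gaussPi
    rw [integral_fintype_prod_eq_prod (𝕜 := ℝ) (fun i (w : ℝ) => Real.sign (K.mulVec u i + s * w)),
      norm_prod]
    calc _ ≤ (∏ i, ‖∫ w, Real.sign (K.mulVec u i + s * w)
            ∂(ProbabilityTheory.gaussianReal 0 1)‖) * 1 :=
          mul_le_mul_of_nonneg_left (prod_abs_le_one _ _)
            (Finset.prod_nonneg fun _ _ => norm_nonneg _)
      _ ≤ _ := by
          rw [mul_one]
          refine Finset.prod_le_prod (fun _ _ => norm_nonneg _) fun i _ => ?_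
          refine (inner_bound _ s hs0).trans (le_of_eq ?_)
          ring
  have hlaw := gauss_law K (ε • (1 : Matrix m m ℝ)) hK
  have hGε : ∀ y, G ((ε • (1 : Matrix m m ℝ)).mulVec y) = ∏ i, (2 / s * ε * |y i|) := by
    intro y
    refine Finset.prod_congr rfl fun i _ => ?_
    rw [Matrix.smul_mulVec, Matrix.one_mulVec, Pi.smul_apply, smul_eq_mul, abs_mul,
      abs_of_nonneg hε]
    ring
  have hint : Integrable (fun u => G (K.mulVec u)) (gaussPi (n ⊕ m)) := by
    have h0 : Integrable G ((gaussPi m).map (fun x => (ε • (1 : Matrix m m ℝ)).mulVec x)) := by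
      rw [integrable_map_measure hG.aestronglyMeasurable (measurable_mulVec _).aemeasurable]
      have : (G ∘ fun x => (ε • (1 : Matrix m m ℝ)).mulVec x)
          = fun y => ∏ i, (2 / s * ε * |y i|) := funext hGε
      rw [this]
      unfold gaussPi
      exact Integrable.fintype_prod (f := fun _ (y : ℝ) => 2 / s * ε * |y|)
        fun i => gauss_abs_integrable.const_mul _
    rw [← hlaw] at h0
    exact (integrable_map_measure hG.aestronglyMeasurable (measurable_mulVec _).aemeasurable).1 h0
  refine (norm_integral_le_of_norm_le hint (Filter.Eventually.of_forall hin)).trans ?_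
  rw [← integral_map (measurable_mulVec K).aemeasurable hG.aestronglyMeasurable, hlaw,
    integral_map (measurable_mulVec _).aemeasurable hG.aestronglyMeasurable]
  simp_rw [hGε]
  unfold gaussPi
  rw [integral_fintype_prod_eq_pow (𝕜 := ℝ) (fun y : ℝ => 2 / s * ε * |y|), integral_const_mul]
  have h2s : 2 / s ≤ 50 := by
    rw [div_le_iff₀ hs0]; linarith
  have hi0 : 0 ≤ ∫ x, |x| ∂(ProbabilityTheory.gaussianReal 0 1) :=
    integral_nonneg fun x => abs_nonneg x
  apply pow_le_pow_left₀ (by positivity)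
  calc _ ≤ 2 / s * ε * 1 := mul_le_mul_of_nonneg_left gauss_abs (by positivity)
    _ ≤ _ := by rw [mul_one]; exact mul_le_mul_of_nonneg_right h2s hε

lemma gauss_ne_zero {ι : Type} [Fintype ι] (a : ι → ℝ) (ha : ∑ k, a k * a k = 1) :
    ∀ᵐ x ∂(gaussPi ι), ∑ k, a k * x k ≠ 0 := by
  have hlaw := gauss_law (Matrix.of fun (_ : Unit) k => a k) (1 : Matrix Unit Unit ℝ) (by
    ext i j
    simp [Matrix.mul_apply, ha])
  have h1 : ∀ᵐ y ∂((gaussPi Unit).map (fun x => (1 : Matrix Unit Unit ℝ).mulVec x)),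
      y () ≠ 0 := by
    simp only [Matrix.one_mulVec]
    rw [Measure.map_id']
    have hmp := measurePreserving_eval (fun _ : Unit => ProbabilityTheory.gaussianReal 0 1) ()
    have h2 : ∀ᵐ y ∂(ProbabilityTheory.gaussianReal 0 1), y ≠ 0 := by
      have : NullSingletonClass (ProbabilityTheory.gaussianReal 0 1) :=
        ProbabilityTheory.nullSingletonClass_gaussianReal one_ne_zero
      exact Measure.ae_ne _ 0
    exact hmp.quasiMeasurePreserving.ae h2
  rw [← hlaw] at h1
  have := ae_of_ae_map (measurable_mulVec _).aemeasurable h1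
  filter_upwards [this] with x hx
  simpa [Matrix.mulVec, dotProduct] using hx

lemma gauss_neg {ι : Type} [Fintype ι] (f : (ι → ℝ) → ℝ) (hf : Measurable f) :
    ∫ x, f x ∂(gaussPi ι) = ∫ x, f (-x) ∂(gaussPi ι) := by
  classical
  have hlaw := gauss_law (-1 : Matrix ι ι ℝ) (1 : Matrix ι ι ℝ) (by simp)
  simp only [Matrix.one_mulVec, Matrix.neg_mulVec] at hlaw
  rw [Measure.map_id'] at hlaw
  conv_lhs => rw [← hlaw]
  rw [integral_map measurable_neg.aemeasurable hf.aestronglyMeasurable]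

lemma opNorm_spec {m n : Type} [Fintype m] [Fintype n] (A : m → n → ℝ) :
    0 ≤ opNorm A ∧ ∀ x : n → ℝ, ∑ i, (∑ j, A i j * x j) ^ 2 ≤ opNorm A ^ 2 * ∑ j, x j ^ 2 := by
  have h0 : 0 ≤ opNorm A := by
    apply Real.sSup_nonneg
    rintro r ⟨x, _, rfl⟩
    positivity
  refine ⟨h0, fun x => ?_⟩
  by_cases hx : x = 0
  · simp [hx]
  have hpos : 0 < ∑ j, x j ^ 2 := by
    obtain ⟨j, hj⟩ := Function.ne_iff.1 hx
    exact Finset.sum_pos' (fun _ _ => sq_nonneg _) ⟨j, Finset.mem_univ _, by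
      have : x j ≠ 0 := hj
      positivity⟩
  have hb : BddAbove {r : ℝ | ∃ x : n → ℝ, x ≠ 0 ∧
      r = Real.sqrt (∑ i, (∑ j, A i j * x j) ^ 2) / Real.sqrt (∑ j, x j ^ 2)} := by
    refine ⟨Real.sqrt (∑ i, ∑ j, A i j ^ 2), ?_⟩
    rintro r ⟨y, _, rfl⟩
    apply div_le_of_le_mul₀ (Real.sqrt_nonneg _) (Real.sqrt_nonneg _)
    rw [← Real.sqrt_mul (by positivity)]
    apply Real.sqrt_le_sqrt
    rw [Finset.sum_mul]
    exact Finset.sum_le_sum fun i _ => Finset.sum_mul_sq_le_sq_mul_sq _ _ _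
  have h1 : Real.sqrt (∑ i, (∑ j, A i j * x j) ^ 2) / Real.sqrt (∑ j, x j ^ 2) ≤ opNorm A :=
    le_csSup hb ⟨x, hx, rfl⟩
  rw [div_le_iff₀ (Real.sqrt_pos.2 hpos)] at h1
  have h2 := pow_le_pow_left₀ (Real.sqrt_nonneg _) h1 2
  rwa [mul_pow, Real.sq_sqrt (by positivity), Real.sq_sqrt hpos.le] at h2

lemma transpose_bound {m n : Type} [Fintype m] [Fintype n] (M : Matrix m n ℝ) (ε : ℝ)
    (h : ∀ x : n → ℝ, ∑ i, (M.mulVec x i) ^ 2 ≤ ε ^ 2 * ∑ j, x j ^ 2) (y : m → ℝ) :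
    ∑ j, (M.transpose.mulVec y j) ^ 2 ≤ ε ^ 2 * ∑ i, y i ^ 2 := by
  set z := M.transpose.mulVec y with hz
  have e : ∑ j, z j ^ 2 = ∑ i, y i * M.mulVec z i := by
    have : y ⬝ᵥ M.mulVec z = z ⬝ᵥ z := by
      rw [Matrix.dotProduct_mulVec, ← Matrix.mulVec_transpose]
    simp only [dotProduct] at this
    rw [this]
    simp_rw [sq]
  have hcs := Finset.sum_mul_sq_le_sq_mul_sq Finset.univ y (M.mulVec z)
  rw [← e] at hcs
  have hz0 : 0 ≤ ∑ j, z j ^ 2 := by positivity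
  have hy0 : 0 ≤ ∑ i, y i ^ 2 := by positivity
  rcases hz0.eq_or_lt with h0 | h0
  · rw [← h0]; positivity
  · have h1 := mul_le_mul_of_nonneg_left (h z) hy0
    have h2 : (∑ j, z j ^ 2) * (∑ j, z j ^ 2) ≤ (ε ^ 2 * ∑ i, y i ^ 2) * ∑ j, z j ^ 2 := by
      nlinarith
    exact le_of_mul_le_mul_right h2 h0

lemma Utilde_eq (N : ℕ) (U : Fin N → Fin N → ℝ) (hU : IsOrthogonal U) (S T : Finset (Fin N)) :
    Utilde N U S T = ∫ X, (∏ i ∈ S, Real.sign (X i)) * ∏ j ∈ T, Real.sign (∑ l, U l j * X l)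
      ∂(gaussPi (Fin N)) := by
  have hS : ∀ᵐ X ∂(gaussPi (Fin N)), ∀ i, X i ≠ 0 := by
    rw [ae_all_iff]
    intro i
    have := gauss_ne_zero (fun k => if k = i then (1 : ℝ) else 0) (by simp)
    filter_upwards [this] with x hx
    simpa using hx
  have hT : ∀ᵐ X ∂(gaussPi (Fin N)), ∀ j, ∑ l, U l j * X l ≠ 0 := by
    rw [ae_all_iff]
    intro j
    exact gauss_ne_zero (fun k => U k j) (by simpa using hU.1 j j)
  change ∫ X, _ ∂(gaussPi (Fin N)) = _
  apply integral_congr_ae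
  filter_upwards [hS, hT] with X h1 h2
  rw [sgn_eq_sign (mul_ne_zero (Finset.prod_ne_zero_iff.2 fun i _ => h1 i)
    (Finset.prod_ne_zero_iff.2 fun j _ => h2 j)), sign_mul', sign_prod', sign_prod']

theorem Utilde_bounds (N : ℕ) (U : Fin N → Fin N → ℝ) (hU : IsOrthogonal U)
    (S T : Finset (Fin N)) :
    (Odd (S.card + T.card) → Utilde N U S T = 0) ∧
    (Even (S.card + T.card) →
      |Utilde N U S T| ≤ (50 * subOpNorm U S T) ^ max S.card T.card) := by
  rw [Utilde_eq N U hU]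
  constructor
  · intro hodd
    have hm : Measurable (fun X : Fin N → ℝ =>
        (∏ i ∈ S, Real.sign (X i)) * ∏ j ∈ T, Real.sign (∑ l, U l j * X l)) := by
      refine Measurable.mul (Finset.measurable_prod _ fun i _ => ?_)
        (Finset.measurable_prod _ fun i _ => ?_)
      · exact measurable_sign'.comp (measurable_pi_apply _)
      · exact measurable_sign'.comp (by fun_prop)
    have h1 := gauss_neg _ hm
    have h2 : ∀ X : Fin N → ℝ,
        (∏ i ∈ S, Real.sign ((-X) i)) * ∏ j ∈ T, Real.sign (∑ l, U l j * (-X) l)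
        = -((∏ i ∈ S, Real.sign (X i)) * ∏ j ∈ T, Real.sign (∑ l, U l j * X l)) := by
      intro X
      simp only [Pi.neg_apply, mul_neg, Finset.sum_neg_distrib, Real.sign_neg, Finset.prod_neg]
      have h3 : (-1 : ℝ) ^ S.card * (-1) ^ T.card = -1 := by rw [← pow_add, hodd.neg_one_pow]
      linear_combination ((∏ i ∈ S, Real.sign (X i)) *
        ∏ j ∈ T, Real.sign (∑ l, U l j * X l)) * h3
    simp_rw [h2] at h1
    rw [integral_neg] at h1
    linarith
  · intro _
    obtain ⟨h0, hop⟩ := opNorm_spec (fun (i : {a // a ∈ S}) (j : {a // a ∈ T}) => U i.val j.val)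
    change 0 ≤ subOpNorm U S T at h0
    change ∀ x, _ ≤ subOpNorm U S T ^ 2 * _ at hop
    set ε := subOpNorm U S T with hε
    by_cases hbig : 1 / 50 ≤ ε
    · have h1 : |∫ X, (∏ i ∈ S, Real.sign (X i)) * ∏ j ∈ T, Real.sign (∑ l, U l j * X l)
          ∂(gaussPi (Fin N))| ≤ 1 := by
        have := norm_integral_le_of_norm_le_const (μ := gaussPi (Fin N)) (C := 1)
          (f := fun X => (∏ i ∈ S, Real.sign (X i)) * ∏ j ∈ T, Real.sign (∑ l, U l j * X l))
          (Filter.Eventually.of_forall fun X => by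
            rw [norm_mul]
            exact mul_le_one₀ (prod_abs_le_one _ _) (abs_nonneg _) (prod_abs_le_one _ _))
        simpa using this
      exact h1.trans (one_le_pow₀ (by linarith))
    · have hsm : ε ≤ 1 / 50 := (not_le.1 hbig).le
      let A : Matrix {a // a ∈ S} (Fin N) ℝ := Matrix.of fun i l => if l = i.val then 1 else 0
      let B : Matrix {a // a ∈ T} (Fin N) ℝ := Matrix.of fun j l => U l j.val
      have hA : A * A.transpose = 1 := by
        ext i j
        rw [Matrix.mul_apply, Matrix.one_apply]
        simp [A]
        congr 1
        exact propext eq_comm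
      have hB : B * B.transpose = 1 := by
        ext i j
        rw [Matrix.mul_apply, Matrix.one_apply]
        simp only [B, Matrix.transpose_apply, Matrix.of_apply]
        rw [hU.1]
        simp only [← Subtype.ext_iff]
      have hAB : A * B.transpose = Matrix.of fun i j => U i.val j.val := by
        ext i j
        simp [A, B, Matrix.mul_apply]
      have hBA : B * A.transpose = (A * B.transpose).transpose := by simp
      have hM : ∀ x : {a // a ∈ T} → ℝ,
          ∑ i, ((A * B.transpose).mulVec x i) ^ 2 ≤ ε ^ 2 * ∑ j, x j ^ 2 := by
        rw [hAB]
        exact hop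
      have hMt := transpose_bound _ ε hM
      have m1 := gauss_main A B hA hB ε h0 hsm hMt
      have m2 := gauss_main B A hB hA ε h0 hsm (by
        rw [hBA, Matrix.transpose_transpose]; exact hM)
      have hAx : ∀ X i, A.mulVec X i = X i.val := by
        intro X i
        simp [A, Matrix.mulVec, dotProduct]
      have hBx : ∀ X j, B.mulVec X j = ∑ l, U l j.val * X l := by
        intro X j
        simp [B, Matrix.mulVec, dotProduct]
      have hP : ∀ X : Fin N → ℝ, (∏ i, Real.sign (A.mulVec X i)) = ∏ i ∈ S, Real.sign (X i) := by
        intro X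
        simp_rw [hAx]
        exact Finset.prod_coe_sort S (fun i => Real.sign (X i))
      have hQ : ∀ X : Fin N → ℝ, (∏ j, Real.sign (B.mulVec X j))
          = ∏ j ∈ T, Real.sign (∑ l, U l j * X l) := by
        intro X
        simp_rw [hBx]
        exact Finset.prod_coe_sort T (fun j => Real.sign (∑ l, U l j * X l))
      simp_rw [hP, hQ] at m1 m2
      rw [Fintype.card_coe] at m1 m2
      rcases max_choice S.card T.card with hc | hc
      · rw [hc]; exact m1
      · rw [hc]
        refine le_trans (le_of_eq ?_) m2
        congr 2
        funext X
        ring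
end
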